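/- There exist constants C > 0 and n₀ ∈ ℕ such that the following holds. For every finite set P ⊆ ℝ² with |P| = n ≥ n₀ and all real numbers 0 ≤ α < β, there exists a solution (Γ, Π) of the partial batched range searching problem for (A, B, α, β) with A = P and B = P, Γ = {(A_t, B_t)} and Π = {(A'_s, B'_s)}, with the following complexities: (1) |Γ| ≤ C·n^{4/3}/(log₂ log₂ n)⁴; (2) Σ_t |A_t| ≤ C·n^{4/3} and Σ_t |B_t| ≤ C·n^{4/3}; (3) |Π| ≤ C·n^{4/3}/(log₂ log₂ n)⁴; (4) |A'_s| ≤ C·(log₂ log₂ n)³ and |B'_s| ≤ C·(log₂ log₂ n)³ for every member (A'_s, B'_s) of Π; consequently (5) Σ_s |A'_s|·|B'_s| ≤ C·n^{4/3}·(log₂ log₂ n)². -/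

import Mathlib

/-- Points of the plane. -/
abbrev Pt : Type := EuclideanSpace ℝ (Fin 2)

/-- `(Gm, Pm)` is a solution of the partial batched range searching problem for
`(A, B, α, β)`: the members of `Gm` and `Pm` are pairs of subsets of `A` and `B`
whose products are pairwise disjoint; every pair of points recorded in `Gm` has
distance in `(α, β]`; and every pair `(a, b) ∈ A × B` with `dist a b ∈ (α, β]`
belongs to the product of exactly one member of `Gm` or exactly one member of `Pm`. -/
def IsPartialBRS (A B : Finset Pt) (α β : ℝ)
    (Gm Pm : Finset (Finset Pt × Finset Pt)) : Prop :=
  (∀ p ∈ Gm, p.1 ⊆ A ∧ p.2 ⊆ B) ∧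
  (∀ p ∈ Pm, p.1 ⊆ A ∧ p.2 ⊆ B) ∧
  (∀ p ∈ Gm, ∀ q ∈ Gm, p ≠ q → Disjoint (p.1 ×ˢ p.2) (q.1 ×ˢ q.2)) ∧
  (∀ p ∈ Pm, ∀ q ∈ Pm, p ≠ q → Disjoint (p.1 ×ˢ p.2) (q.1 ×ˢ q.2)) ∧
  (∀ p ∈ Gm, ∀ q ∈ Pm, Disjoint (p.1 ×ˢ p.2) (q.1 ×ˢ q.2)) ∧
  (∀ p ∈ Gm, ∀ a ∈ p.1, ∀ b ∈ p.2, dist a b ∈ Set.Ioc α β) ∧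
  (∀ a ∈ A, ∀ b ∈ B, dist a b ∈ Set.Ioc α β →
    (∃! p, p ∈ Gm ∧ a ∈ p.1 ∧ b ∈ p.2) ∨ (∃! p, p ∈ Pm ∧ a ∈ p.1 ∧ b ∈ p.2))

section

open Finset

lemma exists_offset (w : ℕ → ℕ) (M E : ℕ) :
    ∃ o < 2 ^ E, ∀ e ≤ E,
      2 ^ e * ∑ k ∈ range M, (if 2 ^ e ∣ k + o then w k else 0) ≤ ∑ k ∈ range M, w k := by
  induction E with
  | zero => exact ⟨0, by simp, by intro e he; obtain rfl : e = 0 := by omega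
                                  simp⟩
  | succ E ih =>
    obtain ⟨o, ho, h⟩ := ih
    have key : ∑ k ∈ range M, (if 2 ^ E ∣ k + o then w k else 0) =
        ∑ k ∈ range M, (if 2 ^ (E + 1) ∣ k + o then w k else 0) +
        ∑ k ∈ range M, (if 2 ^ (E + 1) ∣ k + (o + 2 ^ E) then w k else 0) := by
      rw [← Finset.sum_add_distrib]
      refine Finset.sum_congr rfl fun k _ => ?_
      have hp : 0 < 2 ^ E := by positivity
      generalize hP : 2 ^ E = P at *
      rw [pow_succ, hP]
      by_cases h1 : P ∣ k + o
      · obtain ⟨c, hc⟩ := h1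
        have e1 : P * 2 ∣ k + o ↔ 2 ∣ c := by
          rw [hc, Nat.mul_dvd_mul_iff_left hp]
        have e2 : P * 2 ∣ k + (o + P) ↔ 2 ∣ c + 1 := by
          rw [← add_assoc, hc, ← Nat.mul_succ, Nat.mul_dvd_mul_iff_left hp]
        rw [if_pos ⟨c, hc⟩]
        rcases Nat.even_or_odd' c with ⟨u, hu | hu⟩
        · rw [if_pos (e1.2 (by omega)), if_neg (mt e2.1 (by omega)), add_zero]
        · rw [if_neg (mt e1.1 (by omega)), if_pos (e2.2 (by omega)), zero_add]
      · have e1 : ¬ P * 2 ∣ k + o := fun h => h1 (dvd_trans (dvd_mul_right _ _) h)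
        have e2 : ¬ P * 2 ∣ k + (o + P) := fun h => h1 (by
          have := dvd_trans (dvd_mul_right P 2) h
          rw [← add_assoc] at this
          exact (Nat.dvd_add_left (dvd_refl P)).1 this)
        simp [h1, e1, e2]
    have hE := h E le_rfl
    rw [key] at hE
    have low : ∀ e ≤ E, ∀ k, (2 ^ e ∣ k + (o + 2 ^ E) ↔ 2 ^ e ∣ k + o) := by
      intro e he k
      rw [← add_assoc]
      exact Nat.dvd_add_left (pow_dvd_pow 2 he)
    rcases le_total (∑ k ∈ range M, (if 2 ^ (E + 1) ∣ k + o then w k else 0))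
      (∑ k ∈ range M, (if 2 ^ (E + 1) ∣ k + (o + 2 ^ E) then w k else 0)) with hle | hle
    · refine ⟨o, by rw [pow_succ]; omega, fun e he => ?_⟩
      rcases Nat.lt_or_ge e (E + 1) with h1 | h1
      · exact h e (by omega)
      · obtain rfl : e = E + 1 := by omega
        refine le_trans ?_ hE
        rw [pow_succ 2 E, mul_assoc] at *
        gcongr
        omega
    · refine ⟨o + 2 ^ E, by rw [pow_succ]; omega, fun e he => ?_⟩
      rcases Nat.lt_or_ge e (E + 1) with h1 | h1
      · simpa only [low e (by omega)] using h e (by omega)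
      · obtain rfl : e = E + 1 := by omega
        refine le_trans ?_ hE
        rw [pow_succ 2 E, mul_assoc] at *
        gcongr
        omega

section Rank

variable {ι : Type*} [Fintype ι]

/-- The value of the `i`-th function at time `t`, with ties broken by an enumeration of `ι`. -/
noncomputable def rankKey (F : ι → ℕ → ℝ) (t : ℕ) (i : ι) : ℝ ×ₗ Fin (Fintype.card ι) :=
  toLex (F i t, Fintype.equivFin ι i)

/-- The number of functions that precede the `i`-th one at time `t`. -/
noncomputable def funRank (F : ι → ℕ → ℝ) (t : ℕ) (i : ι) : ℕ :=
  #{j | rankKey F t j < rankKey F t i}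

lemma rankKey_injective (F : ι → ℕ → ℝ) (t : ℕ) : Function.Injective (rankKey F t) := by
  intro i j h
  have := congrArg (fun p => (ofLex p).2) h
  simpa [rankKey] using this

lemma rankKey_lt_iff (F : ι → ℕ → ℝ) (t : ℕ) (i j : ι) :
    rankKey F t i < rankKey F t j ↔
      F i t < F j t ∨ F i t = F j t ∧ Fintype.equivFin ι i < Fintype.equivFin ι j := by
  simp [rankKey, Prod.Lex.toLex_lt_toLex]

lemma funRank_lt_funRank {F : ι → ℕ → ℝ} {t : ℕ} {i j : ι}
    (h : rankKey F t i < rankKey F t j) : funRank F t i < funRank F t j := by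
  refine Finset.card_lt_card (Finset.ssubset_iff_subset_ne.2 ⟨fun k hk => ?_, fun he => ?_⟩)
  · simp only [mem_filter, mem_univ, true_and] at hk ⊢
    exact hk.trans h
  · have : i ∈ ({k | rankKey F t k < rankKey F t j} : Finset ι) := by simpa using h
    rw [← he] at this
    simp at this

lemma funRank_injective (F : ι → ℕ → ℝ) (t : ℕ) : Function.Injective (funRank F t) := by
  intro i j h
  rcases lt_trichotomy (rankKey F t i) (rankKey F t j) with h1 | h1 | h1
  · exact absurd h (funRank_lt_funRank h1).ne
  · exact rankKey_injective F t h1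
  · exact absurd h (funRank_lt_funRank h1).ne'

lemma funRank_lt_card_lt {F : ι → ℕ → ℝ} {t : ℕ} {i : ι} {y : ℝ} (h : F i t < y) :
    funRank F t i < #{j | F j t < y} := by
  refine Finset.card_lt_card (Finset.ssubset_iff_subset_ne.2 ⟨fun k hk => ?_, fun he => ?_⟩)
  · simp only [mem_filter, mem_univ, true_and, rankKey_lt_iff] at hk ⊢
    rcases hk with hk | hk <;> linarith [hk]
  · have : i ∈ ({j | F j t < y} : Finset ι) := by simpa using h
    rw [← he] at this
    simp at this

lemma card_lt_le_funRank {F : ι → ℕ → ℝ} {t : ℕ} {i : ι} {y : ℝ} (h : ¬ F i t < y) :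
    #{j | F j t < y} ≤ funRank F t i := by
  refine Finset.card_le_card fun k hk => ?_
  simp only [mem_filter, mem_univ, true_and, rankKey_lt_iff] at hk ⊢
  left
  linarith

lemma funRank_lt_card (F : ι → ℕ → ℝ) (t : ℕ) (i : ι) : funRank F t i < Fintype.card ι :=
  Finset.card_lt_univ_of_notMem (x := i) (by simp)

/-- The functions that cross the rank threshold `k` between the times `t` and `t + 1`. -/
noncomputable def rankFlips (F : ι → ℕ → ℝ) (k t : ℕ) : Finset ι :=
  {i | ¬ (funRank F t i < k ↔ funRank F (t + 1) i < k)}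

lemma rankFlips_zero (F : ι → ℕ → ℝ) (t : ℕ) : rankFlips F 0 t = ∅ := by
  simp [rankFlips]

lemma rankFlips_of_card_le (F : ι → ℕ → ℝ) {k : ℕ} (t : ℕ) (hk : Fintype.card ι ≤ k) :
    rankFlips F k t = ∅ := by
  ext i
  have h1 := funRank_lt_card F t i
  have h2 := funRank_lt_card F (t + 1) i
  simp only [rankFlips, mem_filter, mem_univ, true_and, notMem_empty, iff_false, not_not]
  exact ⟨fun _ => by omega, fun _ => by omega⟩

lemma card_range_filter_lt_iff (N a b : ℕ) :
    #{k ∈ range N | ¬ (a < k ↔ b < k)} ≤ (a - b) + (b - a) := by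
  have : ({k ∈ range N | ¬ (a < k ↔ b < k)} : Finset ℕ) ⊆ Ioc b a ∪ Ioc a b := by
    intro k hk
    simp only [mem_filter, mem_union, mem_Ioc] at hk ⊢
    omega
  refine (card_le_card this).trans ((card_union_le _ _).trans ?_)
  simp

lemma sum_card_rankFlips_le (F : ι → ℕ → ℝ) (N t : ℕ) :
    ∑ k ∈ range N, #(rankFlips F k t) ≤
      ∑ i, #{j | ¬ (rankKey F t j < rankKey F t i ↔
        rankKey F (t + 1) j < rankKey F (t + 1) i)} := by
  classical
  have h1 : ∑ k ∈ range N, #(rankFlips F k t) =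
      ∑ i, #{k ∈ range N | ¬ (funRank F t i < k ↔ funRank F (t + 1) i < k)} := by
    simp only [rankFlips, Finset.card_filter]
    exact Finset.sum_comm
  rw [h1]
  refine Finset.sum_le_sum fun i _ => (card_range_filter_lt_iff _ _ _).trans ?_
  set S : Finset ι := {j | rankKey F t j < rankKey F t i}
  set S' : Finset ι := {j | rankKey F (t + 1) j < rankKey F (t + 1) i}
  have e1 : funRank F t i - funRank F (t + 1) i ≤ #(S \ S') := Finset.le_card_sdiff _ _
  have e2 : funRank F (t + 1) i - funRank F t i ≤ #(S' \ S) := Finset.le_card_sdiff _ _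
  refine (add_le_add e1 e2).trans ?_
  rw [← Finset.card_union_of_disjoint disjoint_sdiff_sdiff]
  refine Finset.card_le_card fun j hj => ?_
  simp only [S, S', mem_union, mem_sdiff, mem_filter, mem_univ, true_and] at hj ⊢
  tauto

lemma sum_sum_card_rankFlips_le (F : ι → ℕ → ℝ) (N T s : ℕ)
    (hs : ∀ i j, #{t ∈ range T | ¬ (F i t ≤ F j t ↔ F i (t + 1) ≤ F j (t + 1))} ≤ s) :
    ∑ k ∈ range N, ∑ t ∈ range T, #(rankFlips F k t) ≤ s * Fintype.card ι ^ 2 := by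
  classical
  rw [Finset.sum_comm]
  refine (Finset.sum_le_sum fun t _ => sum_card_rankFlips_le F N t).trans ?_
  have : ∑ t ∈ range T, ∑ i, #{j | ¬ (rankKey F t j < rankKey F t i ↔
        rankKey F (t + 1) j < rankKey F (t + 1) i)} =
      ∑ i, ∑ j, #{t ∈ range T | ¬ (rankKey F t j < rankKey F t i ↔
        rankKey F (t + 1) j < rankKey F (t + 1) i)} := by
    simp only [Finset.card_filter]
    rw [Finset.sum_comm]
    exact Finset.sum_congr rfl fun i _ => Finset.sum_comm
  rw [this]
  have hb : ∀ i j, #{t ∈ range T | ¬ (rankKey F t j < rankKey F t i ↔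
        rankKey F (t + 1) j < rankKey F (t + 1) i)} ≤ s := by
    intro i j
    rcases lt_or_ge (Fintype.equivFin ι j) (Fintype.equivFin ι i) with h | h
    · refine (Finset.card_le_card ?_).trans (hs j i)
      intro t
      simp only [mem_filter, rankKey_lt_iff, h, and_true, ← le_iff_lt_or_eq]
      exact id
    · refine (Finset.card_le_card ?_).trans (hs i j)
      intro t
      simp only [mem_filter, rankKey_lt_iff, not_lt.2 h, and_false, or_false]
      rw [← not_le, ← not_le]
      tauto
  refine (Finset.sum_le_sum fun i _ => Finset.sum_le_sum fun j _ => hb i j).trans ?_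
  simp only [sum_const, card_univ, smul_eq_mul]
  apply le_of_eq; ring

end Rank

lemma sum_range_mul_div (h : ℕ → ℕ) (p N : ℕ) (hp : 0 < p) :
    ∑ b ∈ range (N * p), h (b / p) = p * ∑ b ∈ range N, h b := by
  induction N with
  | zero => simp
  | succ N ih =>
    rw [Nat.succ_mul, Finset.sum_range_add, ih, Finset.sum_range_succ, mul_add]
    congr 1
    rw [Finset.sum_congr rfl (g := fun _ => h N)]
    · simp
    · intro i hi
      congr 1
      rw [mul_comm, Nat.mul_add_div hp, Nat.div_eq_of_lt (mem_range.1 hi), add_zero]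

lemma sum_multiples_le (w : ℕ → ℕ) (M N q o : ℕ) (hq : 0 < q) (h0 : w 0 = 0)
    (hM : ∀ k, M ≤ k → w k = 0) :
    ∑ b ∈ range N, w (b * q - o) ≤ ∑ k ∈ range M, if q ∣ k + o then w k else 0 := by
  rw [← Finset.sum_filter, ← Finset.sum_filter_ne_zero]
  have hb : ∀ b ∈ {b ∈ range N | w (b * q - o) ≠ 0}, o < b * q ∧ b * q - o < M := by
    intro b hb
    have hne := (mem_filter.1 hb).2
    refine ⟨?_, ?_⟩
    · by_contra hle
      exact hne (by rw [Nat.sub_eq_zero_of_le (by omega), h0])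
    · by_contra hle
      exact hne (hM _ (by omega))
  rw [← Finset.sum_image (f := w) (g := fun b => b * q - o)]
  · refine Finset.sum_le_sum_of_subset fun k hk => ?_
    obtain ⟨b, hb', rfl⟩ := mem_image.1 hk
    have := hb b hb'
    simp only [mem_filter, mem_range]
    refine ⟨this.2, ?_⟩
    rw [Nat.sub_add_cancel this.1.le]
    exact dvd_mul_left _ _
  · intro b hb1 b' hb2 he
    have h1 := hb b hb1
    have h2 := hb b' hb2
    simp only at he
    exact Nat.eq_of_mul_eq_mul_right hq (by omega)

section Labels

variable {ι : Type*} [Fintype ι]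

/-- The total number of crossings of the rank threshold `k` before time `t`. -/
noncomputable def flipCount (F : ι → ℕ → ℝ) (k t : ℕ) : ℕ :=
  ∑ u ∈ range t, #(rankFlips F k u)

/-- The number of crossings of the two boundaries of the `b`-th band of width `q`. -/
noncomputable def bandFlips (F : ι → ℕ → ℝ) (o q b t : ℕ) : ℕ :=
  flipCount F (b * q - o) t + flipCount F ((b + 1) * q - o) t

/-- The index of the time interval containing `t` into which the `b`-th band of depth `d`
is cut, all the cuts of the enclosing bands being taken into account. -/
noncomputable def cutIndex (F : ι → ℕ → ℝ) (o E d b t : ℕ) : ℕ :=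
  ∑ d' ∈ range (d + 1), bandFlips F o (2 ^ (E - d')) (b / 2 ^ (d - d')) t / 2 ^ (E - d')

/-- The class, at depth `d`, of a point at height `y` and time `t`. -/
noncomputable def cellLabel (F : ι → ℕ → ℝ) (o E d t : ℕ) (y : ℝ) : ℕ × ℕ :=
  ((#{j | F j t < y} + o) / 2 ^ (E - d),
    cutIndex F o E d ((#{j | F j t < y} + o) / 2 ^ (E - d)) t)

lemma flipCount_mono (F : ι → ℕ → ℝ) (k : ℕ) : Monotone (flipCount F k) := fun _ _ h =>
  Finset.sum_le_sum_of_subset (Finset.range_mono h)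

lemma bandFlips_mono (F : ι → ℕ → ℝ) (o q b : ℕ) : Monotone (bandFlips F o q b) := fun _ _ h =>
  add_le_add (flipCount_mono F _ h) (flipCount_mono F _ h)

lemma cutIndex_mono (F : ι → ℕ → ℝ) (o E d b : ℕ) : Monotone (cutIndex F o E d b) :=
  fun _ _ h => Finset.sum_le_sum fun _ _ => Nat.div_le_div_right (bandFlips_mono F _ _ _ h)

lemma bandFlips_div_eq {F : ι → ℕ → ℝ} {o E d b t t' : ℕ}
    (h : cutIndex F o E d b t = cutIndex F o E d b t') {d' : ℕ} (hd : d' ≤ d) :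
    bandFlips F o (2 ^ (E - d')) (b / 2 ^ (d - d')) t / 2 ^ (E - d') =
      bandFlips F o (2 ^ (E - d')) (b / 2 ^ (d - d')) t' / 2 ^ (E - d') := by
  wlog hle : t ≤ t' generalizing t t'
  · exact (this h.symm (le_of_not_ge hle)).symm
  exact (Finset.sum_eq_sum_iff_of_le fun i _ =>
    Nat.div_le_div_right (bandFlips_mono F _ _ _ hle)).1 h d' (mem_range.2 (by omega))

lemma div_pow_sub_div (x : ℕ) {E d d' : ℕ} (h : d' ≤ d) (hd : d ≤ E) :
    x / 2 ^ (E - d) / 2 ^ (d - d') = x / 2 ^ (E - d') := by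
  rw [Nat.div_div_eq_div_mul, ← pow_add]
  congr 3
  omega

lemma cellLabel_nested {F : ι → ℕ → ℝ} {o E d d' t t' : ℕ} {y y' : ℝ} (h : d' ≤ d) (hd : d ≤ E)
    (he : cellLabel F o E d t y = cellLabel F o E d t' y') :
    cellLabel F o E d' t y = cellLabel F o E d' t' y' := by
  simp only [cellLabel, Prod.mk.injEq] at he ⊢
  obtain ⟨h1, h2⟩ := he
  have h3 : (#{j | F j t < y} + o) / 2 ^ (E - d') = (#{j | F j t' < y'} + o) / 2 ^ (E - d') := by
    rw [← div_pow_sub_div _ h hd, h1, div_pow_sub_div _ h hd]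
  refine ⟨h3, ?_⟩
  rw [← h1] at h2
  rw [← h3]
  refine Finset.sum_congr rfl fun d'' hd'' => ?_
  have hd'' : d'' ≤ d' := by have := mem_range.1 hd''; omega
  have := bandFlips_div_eq h2 (hd''.trans h)
  rw [div_pow_sub_div _ (hd''.trans h) hd] at this
  rw [div_pow_sub_div _ hd'' (h.trans hd)]
  exact this

open Classical in
lemma card_rank_changed_le (F : ι → ℕ → ℝ) (k t₀ t₁ : ℕ) (h : t₀ ≤ t₁) :
    #{i | ∃ t, t₀ ≤ t ∧ t ≤ t₁ ∧ ¬ (funRank F t₀ i < k ↔ funRank F t i < k)} + flipCount F k t₀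
      ≤ flipCount F k t₁ := by
  classical
  have hsub : ({i | ∃ t, t₀ ≤ t ∧ t ≤ t₁ ∧ ¬ (funRank F t₀ i < k ↔ funRank F t i < k)} : Finset ι)
      ⊆ (Ico t₀ t₁).biUnion fun t => rankFlips F k t := by
    intro i hi
    simp only [mem_filter, mem_univ, true_and] at hi
    by_contra hcon
    simp only [mem_biUnion, mem_Ico, rankFlips, mem_filter, mem_univ, true_and, not_exists,
      not_and, not_not] at hcon
    obtain ⟨t, h0, h1, hne⟩ := hi
    apply hne
    induction t, h0 using Nat.le_induction with
    | base => rfl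
    | succ t h0 ih =>
      have := hcon t ⟨h0, by omega⟩
      by_cases hc : funRank F t₀ i < k ↔ funRank F t i < k
      · exact hc.trans this
      · exact absurd (ih (by omega) hc) hc
  have h1 := (Finset.card_le_card hsub).trans Finset.card_biUnion_le
  have h2 : flipCount F k t₁ = flipCount F k t₀ + ∑ t ∈ Ico t₀ t₁, #(rankFlips F k t) := by
    unfold flipCount
    exact (Finset.sum_range_add_sum_Ico _ h).symm
  omega

open Classical in
lemma card_split_cell_le (F : ι → ℕ → ℝ) (o E d : ℕ) {α : Type*} (A : Finset α)
    (τ : α → ℕ) (y : α → ℝ) (v : ℕ × ℕ) :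
    #{i | ∃ a ∈ A, ∃ a' ∈ A, cellLabel F o E d (τ a) (y a) = v ∧
      cellLabel F o E d (τ a') (y a') = v ∧ F i (τ a) < y a ∧ ¬ F i (τ a') < y a'} ≤
      2 * 2 ^ (E - d) := by
  classical
  set S := {a ∈ A | cellLabel F o E d (τ a) (y a) = v} with hS
  rcases S.eq_empty_or_nonempty with he | hne
  · refine le_of_eq_of_le (Finset.card_eq_zero.2 ?_) (Nat.zero_le _)
    ext i
    simp only [mem_filter, mem_univ, true_and, notMem_empty, iff_false, not_exists, not_and]
    intro a ha a' _ hv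
    have : a ∈ S := by simp [hS, ha, hv]
    simp [he] at this
  obtain ⟨a₀, ha₀, hmin⟩ := S.exists_min_image τ hne
  obtain ⟨a₁, ha₁, hmax⟩ := S.exists_max_image τ hne
  set q := 2 ^ (E - d) with hq
  have hqpos : 0 < q := by positivity
  set b := v.1 with hb
  set t₀ := τ a₀
  set t₁ := τ a₁
  have hband : ∀ a ∈ S, b * q ≤ #{j | F j (τ a) < y a} + o ∧
      #{j | F j (τ a) < y a} + o < (b + 1) * q := by
    intro a ha
    have h1 : (#{j | F j (τ a) < y a} + o) / q = b := by
      rw [hb, ← (mem_filter.1 ha).2]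
      rfl
    rw [← h1]
    exact ⟨Nat.div_mul_le_self _ _, by
      rw [mul_comm]; exact Nat.lt_mul_div_succ _ hqpos⟩
  let R : ℕ → Finset ι := fun k =>
    {i | ∃ t, t₀ ≤ t ∧ t ≤ t₁ ∧ ¬ (funRank F t₀ i < k ↔ funRank F t i < k)}
  have h01 : t₀ ≤ t₁ := hmin _ ha₁
  have hR : #(R (b * q - o)) + #(R ((b + 1) * q - o)) ≤ q := by
    have e1 := card_rank_changed_le F (b * q - o) t₀ t₁ h01
    have e2 := card_rank_changed_le F ((b + 1) * q - o) t₀ t₁ h01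
    have e3 : cutIndex F o E d b t₀ = cutIndex F o E d b t₁ := by
      have u0 := (mem_filter.1 ha₀).2
      have u1 := (mem_filter.1 ha₁).2
      have w0 : cutIndex F o E d b t₀ = v.2 := by
        rw [← congrArg Prod.snd u0, hb, ← congrArg Prod.fst u0]; rfl
      have w1 : cutIndex F o E d b t₁ = v.2 := by
        rw [← congrArg Prod.snd u1, hb, ← congrArg Prod.fst u1]; rfl
      rw [w0, w1]
    have e4 := bandFlips_div_eq e3 le_rfl
    rw [Nat.sub_self, pow_zero, Nat.div_one, ← hq] at e4
    have e5 := Nat.lt_mul_div_succ (bandFlips F o q b t₁) hqpos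
    have e6 := Nat.div_mul_le_self (bandFlips F o q b t₀) q
    rw [← e4, mul_add, mul_comm, mul_one] at e5
    unfold bandFlips at e5 e6
    have e7 : bandFlips F o q b t₁ = flipCount F (b * q - o) t₁ +
      flipCount F ((b + 1) * q - o) t₁ := rfl
    simp only [R]
    unfold bandFlips at *
    omega
  let Q : Finset ι := {i | b * q ≤ funRank F t₀ i + o ∧ funRank F t₀ i + o < (b + 1) * q}
  have hQ : #Q ≤ q := by
    have : #Q ≤ #(Ico (b * q) ((b + 1) * q)) := by
      refine Finset.card_le_card_of_injOn (fun i => funRank F t₀ i + o) ?_ ?_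
      · intro i hi
        simpa [Q] using hi
      · intro i _ j _ hij
        exact funRank_injective F t₀ (by simpa using hij)
    rw [Nat.card_Ico, add_mul, one_mul] at this
    omega
  have hsub : ({i | ∃ a ∈ A, ∃ a' ∈ A, cellLabel F o E d (τ a) (y a) = v ∧
      cellLabel F o E d (τ a') (y a') = v ∧ F i (τ a) < y a ∧ ¬ F i (τ a') < y a'} : Finset ι) ⊆
      Q ∪ (R (b * q - o) ∪ R ((b + 1) * q - o)) := by
    intro i hi
    simp only [mem_filter, mem_univ, true_and] at hi
    obtain ⟨a, ha, a', ha', hv, hv', h1, h2⟩ := hi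
    have haS : a ∈ S := mem_filter.2 ⟨ha, hv⟩
    have haS' : a' ∈ S := mem_filter.2 ⟨ha', hv'⟩
    by_contra hcon
    simp only [mem_union, not_or, R, mem_filter, mem_univ, true_and, not_exists, not_and, not_not,
      Q] at hcon
    obtain ⟨c1, c2, c3⟩ := hcon
    have r1 := funRank_lt_card_lt h1
    have r2 := card_lt_le_funRank h2
    have b1 := hband a haS
    have b2 := hband a' haS'
    have d1 := c3 (τ a) (hmin a haS) (hmax a haS)
    have d2 := c2 (τ a') (hmin a' haS') (hmax a' haS')
    generalize b * q = x at *
    generalize (b + 1) * q = z at *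
    omega
  have := (Finset.card_le_card hsub).trans (card_union_le _ _)
  have := card_union_le (R (b * q - o)) (R ((b + 1) * q - o))
  omega

lemma sum_cutIndex_le (F : ι → ℕ → ℝ) (T s o E d : ℕ) (hd : d ≤ E) (hcard : Fintype.card ι ≤ 2 ^ E)
    (hs : ∀ i j, #{t ∈ range T | ¬ (F i t ≤ F j t ↔ F i (t + 1) ≤ F j (t + 1))} ≤ s)
    (ho : ∀ e ≤ E, 2 ^ e * ∑ k ∈ range (Fintype.card ι),
      (if 2 ^ e ∣ k + o then flipCount F k T else 0) ≤
        ∑ k ∈ range (Fintype.card ι), flipCount F k T) :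
    ∑ b ∈ range (2 * 2 ^ d + 1), cutIndex F o E d b T ≤ 4 * s * 4 ^ d := by
  set m := Fintype.card ι
  have htot : ∑ k ∈ range m, flipCount F k T ≤ s * 4 ^ E := by
    refine (sum_sum_card_rankFlips_le F m T s hs).trans ?_
    have : m ^ 2 ≤ (2 ^ E) ^ 2 := Nat.pow_le_pow_left hcard 2
    rw [← pow_mul, mul_comm E 2, pow_mul] at this
    exact Nat.mul_le_mul_left s this
  have h0 : flipCount F 0 T = 0 := by simp [flipCount, rankFlips_zero]
  have hm : ∀ k, m ≤ k → flipCount F k T = 0 := fun k hk => by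
    simp [flipCount, rankFlips_of_card_le F _ hk]
  have hlevel : ∀ d' ≤ d, ∑ b ∈ range (2 * 2 ^ d' + 1),
      bandFlips F o (2 ^ (E - d')) b T / 2 ^ (E - d') ≤ 2 * s * 4 ^ d' := by
    intro d' hd'
    set q := 2 ^ (E - d') with hq
    have hqpos : 0 < q := by positivity
    have e0 := ho (E - d') (Nat.sub_le _ _)
    rw [← hq] at e0
    have e1 := sum_multiples_le (fun k => flipCount F k T) m (2 * 2 ^ d' + 1) q o hqpos h0 hm
    have e2 := sum_multiples_le (fun k => flipCount F k T) m (2 * 2 ^ d' + 1 + 1) q o hqpos h0 hm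
    rw [Finset.sum_range_succ'] at e2
    have e3 : q * ∑ b ∈ range (2 * 2 ^ d' + 1), bandFlips F o q b T / q ≤
        ∑ b ∈ range (2 * 2 ^ d' + 1), flipCount F (b * q - o) T +
        ∑ b ∈ range (2 * 2 ^ d' + 1), flipCount F ((b + 1) * q - o) T := by
      rw [← Finset.sum_add_distrib, Finset.mul_sum]
      exact Finset.sum_le_sum fun b _ => Nat.mul_div_le _ _
    have e4 : q * q * 4 ^ d' = 4 ^ E := by
      rw [hq, ← mul_pow, show 2 * 2 = 4 by norm_num, ← pow_add]
      congr 1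
      omega
    have e5 : q * (q * ∑ b ∈ range (2 * 2 ^ d' + 1), bandFlips F o q b T / q) ≤
        2 * (s * 4 ^ E) := by
      refine (Nat.mul_le_mul_left q (e3.trans (add_le_add e1 (Nat.le_of_add_right_le e2)))).trans ?_
      rw [mul_add]
      have := e0.trans htot
      omega
    rw [← e4] at e5
    have hqq : 0 < q * q := by positivity
    refine Nat.le_of_mul_le_mul_left ?_ hqq
    calc _ = q * (q * ∑ b ∈ range (2 * 2 ^ d' + 1), bandFlips F o q b T / q) := by ring
      _ ≤ _ := e5
      _ = _ := by ring
  unfold cutIndex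
  rw [Finset.sum_comm]
  have hterm : ∀ d' ∈ range (d + 1), ∑ b ∈ range (2 * 2 ^ d + 1),
      bandFlips F o (2 ^ (E - d')) (b / 2 ^ (d - d')) T / 2 ^ (E - d') ≤
        2 * s * 2 ^ d * 2 ^ d' := by
    intro d' hd'
    have hd' : d' ≤ d := by have := mem_range.1 hd'; omega
    have hpp : 2 ^ d = 2 ^ d' * 2 ^ (d - d') := by rw [← pow_add]; congr 1; omega
    have hp1 : 1 ≤ 2 ^ (d - d') := Nat.one_le_two_pow
    calc _ ≤ ∑ b ∈ range ((2 * 2 ^ d' + 1) * 2 ^ (d - d')),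
          bandFlips F o (2 ^ (E - d')) (b / 2 ^ (d - d')) T / 2 ^ (E - d') := by
            refine Finset.sum_le_sum_of_subset (Finset.range_mono ?_)
            rw [hpp, add_mul, one_mul, mul_assoc]
            omega
      _ = 2 ^ (d - d') * ∑ b ∈ range (2 * 2 ^ d' + 1),
          bandFlips F o (2 ^ (E - d')) b T / 2 ^ (E - d') :=
            sum_range_mul_div (fun b => bandFlips F o (2 ^ (E - d')) b T / 2 ^ (E - d')) _ _
              (by positivity)
      _ ≤ 2 ^ (d - d') * (2 * s * 4 ^ d') := Nat.mul_le_mul_left _ (hlevel d' hd')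
      _ = _ := by
            rw [hpp, show (4 : ℕ) = 2 * 2 by norm_num, mul_pow]
            ring
  refine (Finset.sum_le_sum hterm).trans ?_
  rw [← Finset.mul_sum]
  have hgeo : ∑ d' ∈ range (d + 1), 2 ^ d' ≤ 2 * 2 ^ d := by
    have := Nat.geomSum_eq (le_refl 2) (d + 1)
    rw [this, pow_succ]
    omega
  calc _ ≤ 2 * s * 2 ^ d * (2 * 2 ^ d) := Nat.mul_le_mul_left _ hgeo
    _ = 4 * s * (2 * 2) ^ d := by rw [mul_pow]; ring
    _ = _ := by norm_num

open Classical in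
/-- A hierarchical cutting for finitely many functions sampled at integer times. -/
theorem exists_nested_labels (F : ι → ℕ → ℝ) (T s E : ℕ) (hcard : Fintype.card ι ≤ 2 ^ E)
    (hs : ∀ i j, #{t ∈ range T | ¬ (F i t ≤ F j t ↔ F i (t + 1) ≤ F j (t + 1))} ≤ s)
    {α : Type*} (A : Finset α) (τ : α → ℕ) (y : α → ℝ) (hτ : ∀ a ∈ A, τ a ≤ T) :
    ∃ L : ℕ → α → ℕ × ℕ,
      (∀ d d', d' ≤ d → d ≤ E → ∀ a a', L d a = L d a' → L d' a = L d' a') ∧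
      (∀ d ≤ E, #(A.image (L d)) ≤ (4 * s + 3) * 4 ^ d) ∧
      ∀ d v, #{i | ∃ a ∈ A, ∃ a' ∈ A, L d a = v ∧ L d a' = v ∧
        F i (τ a) < y a ∧ ¬ F i (τ a') < y a'} ≤ 2 * 2 ^ (E - d) := by
  classical
  obtain ⟨o, ho, hoff⟩ := exists_offset (fun k => flipCount F k T) (Fintype.card ι) E
  refine ⟨fun d a => cellLabel F o E d (τ a) (y a), fun d d' h hd a a' he => ?_, fun d hd => ?_,
    fun d v => card_split_cell_le F o E d A τ y v⟩
  · exact cellLabel_nested h hd he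
  have hsub : A.image (fun a => cellLabel F o E d (τ a) (y a)) ⊆
      (range (2 * 2 ^ d + 1)).biUnion fun b =>
        (range (cutIndex F o E d b T + 1)).image fun φ => (b, φ) := by
    intro p hp
    obtain ⟨a, ha, rfl⟩ := mem_image.1 hp
    simp only [mem_biUnion, mem_range, mem_image, cellLabel, Prod.mk.injEq]
    refine ⟨_, ?_, _, Nat.lt_succ_of_le (cutIndex_mono F o E d _ (hτ a ha)), rfl, rfl⟩
    have hle : #{j | F j (τ a) < y a} ≤ Fintype.card ι := Finset.card_le_univ _
    rw [Nat.lt_succ_iff]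
    refine Nat.div_le_of_le_mul ?_
    have : 2 ^ (E - d) * 2 ^ d = 2 ^ E := by rw [← pow_add]; congr 1; omega
    nlinarith
  refine (Finset.card_le_card hsub).trans (Finset.card_biUnion_le.trans ?_)
  refine (Finset.sum_le_sum fun b _ => Finset.card_image_le).trans ?_
  simp only [card_range]
  rw [Finset.sum_add_distrib]
  have h1 := sum_cutIndex_le F T s o E d hd hcard hs hoff
  have h2 : 2 ^ d ≤ 4 ^ d := Nat.pow_le_pow_left (by norm_num) d
  have h3 : 1 ≤ 4 ^ d := Nat.one_le_pow _ _ (by norm_num)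
  simp only [sum_const, card_range, smul_eq_mul, mul_one]
  rw [add_mul]
  omega

end Labels

lemma exists_finset_roots_quadratic (a b c : ℝ) (h : ¬ (a = 0 ∧ b = 0 ∧ c = 0)) :
    ∃ Z : Finset ℝ, #Z ≤ 2 ∧ ∀ x, a * x ^ 2 + b * x + c = 0 → x ∈ Z := by
  classical
  set p : Polynomial ℝ := Polynomial.C a * Polynomial.X ^ 2 + Polynomial.C b * Polynomial.X +
    Polynomial.C c with hp
  have hp0 : p ≠ 0 := by
    intro h0
    refine h ⟨?_, ?_, ?_⟩
    · simpa [hp, Polynomial.coeff_X, Polynomial.coeff_C] using congrArg (fun q => q.coeff 2) h0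
    · simpa [hp, Polynomial.coeff_X, Polynomial.coeff_C, Polynomial.coeff_X_pow]
        using congrArg (fun q => q.coeff 1) h0
    · simpa [hp] using congrArg (fun q => q.coeff 0) h0
  refine ⟨p.roots.toFinset, (Multiset.toFinset_card_le _).trans ((Polynomial.card_roots' p).trans
    Polynomial.natDegree_quadratic_le), fun x hx => ?_⟩
  rw [Multiset.mem_toFinset, Polynomial.mem_roots hp0]
  simpa [hp, Polynomial.IsRoot] using hx

lemma exists_zero_of_not_iff {h : ℝ → ℝ} (hc : Continuous h) {x x' : ℝ} (hx : x ≤ x')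
    (hne : ¬ (h x ≤ 0 ↔ h x' ≤ 0)) : ∃ z, x ≤ z ∧ z ≤ x' ∧ h z = 0 := by
  have h0 : (0 : ℝ) ∈ Set.uIcc (h x) (h x') := by
    rw [Set.mem_uIcc]
    by_cases h1 : h x ≤ 0
    · left
      exact ⟨h1, le_of_not_ge fun h2 => hne ⟨fun _ => h2, fun _ => h1⟩⟩
    · right
      refine ⟨?_, le_of_not_ge h1⟩
      by_contra h2
      exact hne ⟨fun h => absurd h h1, fun h => absurd h h2⟩
  obtain ⟨z, hz, hz0⟩ := intermediate_value_uIcc hc.continuousOn h0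
  rw [Set.uIcc_of_le hx] at hz
  exact ⟨z, hz.1, hz.2, hz0⟩

/-- The upper (`σ = 1`) or lower (`σ = -1`) half of the circle of radius `R` centred at `(a, c)`,
extended to the whole line by the constant `c`. -/
noncomputable def circArc (a c R σ x : ℝ) : ℝ := c + σ * √(R ^ 2 - (x - a) ^ 2)

lemma circArc_breakpoints (a₁ c₁ R₁ σ₁ a₂ c₂ R₂ σ₂ : ℝ) (h₁ : σ₁ ^ 2 = 1) (h₂ : σ₂ ^ 2 = 1) :
    ∃ Z : Finset ℝ, #Z ≤ 10 ∧ ∀ x x', x ≤ x' → (∀ z ∈ Z, ¬ (x ≤ z ∧ z ≤ x')) →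
      (circArc a₁ c₁ R₁ σ₁ x ≤ circArc a₂ c₂ R₂ σ₂ x ↔
        circArc a₁ c₁ R₁ σ₁ x' ≤ circArc a₂ c₂ R₂ σ₂ x') := by
  classical
  obtain ⟨Z₁, k₁, z₁⟩ := exists_finset_roots_quadratic (-1) (2 * a₁) (R₁ ^ 2 - a₁ ^ 2) (by norm_num)
  obtain ⟨Z₂, k₂, z₂⟩ := exists_finset_roots_quadratic (-1) (2 * a₂) (R₂ ^ 2 - a₂ ^ 2) (by norm_num)
  obtain ⟨Z₃, k₃, z₃⟩ := exists_finset_roots_quadratic (-1) (2 * a₁)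
    (R₁ ^ 2 - a₁ ^ 2 - (c₁ - c₂) ^ 2) (by norm_num)
  obtain ⟨Z₄, k₄, z₄⟩ := exists_finset_roots_quadratic (-1) (2 * a₂)
    (R₂ ^ 2 - a₂ ^ 2 - (c₁ - c₂) ^ 2) (by norm_num)
  set c := c₁ - c₂ with hc
  set l := 2 * (a₂ - a₁) with hl
  set l₀ := R₂ ^ 2 - R₁ ^ 2 + a₁ ^ 2 - a₂ ^ 2 - c ^ 2 with hl₀
  have hQ : ∃ Z : Finset ℝ, #Z ≤ 2 ∧ ((c = 0 ∧ a₁ = a₂ ∧ R₁ ^ 2 = R₂ ^ 2) ∨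
      ∀ x, 4 * c ^ 2 * (R₁ ^ 2 - (x - a₁) ^ 2) - (l * x + l₀) ^ 2 = 0 → x ∈ Z) := by
    by_cases hdeg : -4 * c ^ 2 - l ^ 2 = 0 ∧ 8 * c ^ 2 * a₁ - 2 * l * l₀ = 0 ∧
        4 * c ^ 2 * (R₁ ^ 2 - a₁ ^ 2) - l₀ ^ 2 = 0
    · refine ⟨∅, by simp, Or.inl ?_⟩
      obtain ⟨d₁, -, d₃⟩ := hdeg
      have hc0 : c = 0 := by
        have : c ^ 2 = 0 := by nlinarith [sq_nonneg c, sq_nonneg l]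
        simpa using this
      have hl0 : l = 0 := by
        have : l ^ 2 = 0 := by nlinarith [sq_nonneg c, sq_nonneg l]
        simpa using this
      have ha : a₁ = a₂ := by linarith
      have hl₀0 : l₀ = 0 := by
        rw [hc0] at d₃
        have : l₀ ^ 2 = 0 := by linarith
        simpa using this
      refine ⟨hc0, ha, ?_⟩
      rw [hc0, ha] at hl₀
      linarith
    · obtain ⟨Z, hZ, hz⟩ := exists_finset_roots_quadratic _ _ _ hdeg
      refine ⟨Z, hZ, Or.inr fun x hx => hz x ?_⟩
      rw [← hx]
      ring
  obtain ⟨Z₅, k₅, z₅⟩ := hQ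
  refine ⟨Z₁ ∪ Z₂ ∪ Z₃ ∪ Z₄ ∪ Z₅, ?_, fun x x' hx hZ => ?_⟩
  · have u₁ := card_union_le Z₁ Z₂
    have u₂ := card_union_le (Z₁ ∪ Z₂) Z₃
    have u₃ := card_union_le (Z₁ ∪ Z₂ ∪ Z₃) Z₄
    have u₄ := card_union_le (Z₁ ∪ Z₂ ∪ Z₃ ∪ Z₄) Z₅
    omega
  simp only [mem_union] at hZ
  have hsub : ∀ w, circArc a₁ c₁ R₁ σ₁ w ≤ circArc a₂ c₂ R₂ σ₂ w ↔
      circArc a₁ c₁ R₁ σ₁ w - circArc a₂ c₂ R₂ σ₂ w ≤ 0 := fun w => sub_nonpos.symm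
  rw [hsub, hsub]
  by_contra hne
  obtain ⟨z, hxz, hzx, hz⟩ := exists_zero_of_not_iff
    (h := fun w => circArc a₁ c₁ R₁ σ₁ w - circArc a₂ c₂ R₂ σ₂ w)
    (by unfold circArc; fun_prop) hx hne
  have hin : ∀ w, x ≤ w → w ≤ x' → w ∉ Z₁ ∧ w ∉ Z₂ ∧ w ∉ Z₃ ∧ w ∉ Z₄ ∧ w ∉ Z₅ := by
    intro w hw hw'
    have := fun h => hZ w h ⟨hw, hw'⟩
    tauto
  have sgn : ∀ a R : ℝ, (∀ w, x ≤ w → w ≤ x' → R ^ 2 - (w - a) ^ 2 ≠ 0) →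
      ∀ u v, x ≤ u → u ≤ v → v ≤ x' → (R ^ 2 - (u - a) ^ 2 ≤ 0 ↔ R ^ 2 - (v - a) ^ 2 ≤ 0) := by
    intro a R hnz u v hu huv hv
    by_contra hcon
    obtain ⟨w, hw, hw', h0⟩ := exists_zero_of_not_iff
      (h := fun w => R ^ 2 - (w - a) ^ 2) (by fun_prop) huv hcon
    exact hnz w (hu.trans hw) (hw'.trans hv) h0
  have nz₁ : ∀ w, x ≤ w → w ≤ x' → R₁ ^ 2 - (w - a₁) ^ 2 ≠ 0 := fun w hw hw' h =>
    (hin w hw hw').1 (z₁ w (by rw [← h]; ring))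
  have nz₂ : ∀ w, x ≤ w → w ≤ x' → R₂ ^ 2 - (w - a₂) ^ 2 ≠ 0 := fun w hw hw' h =>
    (hin w hw hw').2.1 (z₂ w (by rw [← h]; ring))
  have s₁ := sgn a₁ R₁ nz₁
  have s₂ := sgn a₂ R₂ nz₂
  obtain ⟨-, -, n₃, n₄, n₅⟩ := hin z hxz hzx
  simp only [circArc] at hz hne
  have hz' : c + σ₁ * √(R₁ ^ 2 - (z - a₁) ^ 2) = σ₂ * √(R₂ ^ 2 - (z - a₂) ^ 2) := by
    rw [hc]; linarith
  rcases le_or_gt (R₁ ^ 2 - (z - a₁) ^ 2) 0 with g₁ | g₁ <;>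
    rcases le_or_gt (R₂ ^ 2 - (z - a₂) ^ 2) 0 with g₂ | g₂
  · apply hne
    rw [Real.sqrt_eq_zero_of_nonpos ((s₁ x z le_rfl hxz hzx).2 g₁),
      Real.sqrt_eq_zero_of_nonpos ((s₁ z x' hxz hzx le_rfl).1 g₁),
      Real.sqrt_eq_zero_of_nonpos ((s₂ x z le_rfl hxz hzx).2 g₂),
      Real.sqrt_eq_zero_of_nonpos ((s₂ z x' hxz hzx le_rfl).1 g₂)]
  · rw [Real.sqrt_eq_zero_of_nonpos g₁, mul_zero, add_zero] at hz'
    refine n₄ (z₄ z ?_)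
    have := Real.sq_sqrt g₂.le
    rw [hz', mul_pow, h₂, one_mul, this]
    ring
  · rw [Real.sqrt_eq_zero_of_nonpos g₂, mul_zero] at hz'
    refine n₃ (z₃ z ?_)
    have := Real.sq_sqrt g₁.le
    have hcz : c = -(σ₁ * √(R₁ ^ 2 - (z - a₁) ^ 2)) := by linarith
    rw [hcz, neg_sq, mul_pow, h₁, one_mul, this]
    ring
  · have q₁ := Real.sq_sqrt g₁.le
    have q₂ := Real.sq_sqrt g₂.le
    rcases z₅ with ⟨hc0, ha, hR⟩ | z₅
    · rw [← ha, ← hR, hc0, zero_add] at hz'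
      have hpos := Real.sqrt_pos.2 g₁
      have hσ : σ₁ = σ₂ := mul_right_cancel₀ hpos.ne' hz'
      apply hne
      have hc12 : c₁ = c₂ := by linarith
      rw [ha, hR, hσ, hc12]
      simp
    · refine n₅ (z₅ z ?_)
      set g := √(R₁ ^ 2 - (z - a₁) ^ 2)
      set g' := √(R₂ ^ 2 - (z - a₂) ^ 2)
      have e₁ : (c + σ₁ * g) ^ 2 = g' ^ 2 := by rw [hz', mul_pow, h₂, one_mul]
      have e₂ : 2 * c * (σ₁ * g) = l * z + l₀ := by
        have : (σ₁ * g) ^ 2 = g ^ 2 := by rw [mul_pow, h₁, one_mul]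
        rw [hl₀, hl]
        linear_combination e₁ - this - q₁ + q₂
      rw [← e₂, ← q₁]
      linear_combination (-4 * c ^ 2 * g ^ 2) * h₁

lemma card_changes_le {p : ℝ → Prop} [DecidablePred p] (Z : Finset ℝ)
    (hp : ∀ x x', x ≤ x' → (∀ z ∈ Z, ¬ (x ≤ z ∧ z ≤ x')) → (p x ↔ p x'))
    {xs : ℕ → ℝ} (hxs : Monotone xs) (T : ℕ) :
    #{t ∈ range T | ¬ (p (xs t) ↔ p (xs (t + 1)))} ≤ 2 * #Z := by
  classical
  have hz : ∀ t ∈ {t ∈ range T | ¬ (p (xs t) ↔ p (xs (t + 1)))},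
      ∃ z ∈ Z, xs t ≤ z ∧ z ≤ xs (t + 1) := by
    intro t ht
    by_contra hcon
    push Not at hcon
    exact (mem_filter.1 ht).2 (hp _ _ (hxs (Nat.le_succ t)) fun z hz h =>
      absurd h.2 (not_le.2 (hcon z hz h.1)))
  choose! ζ hζ using hz
  have : #{t ∈ range T | ¬ (p (xs t) ↔ p (xs (t + 1)))} ≤ #(Z ×ˢ (univ : Finset Bool)) := by
    refine Finset.card_le_card_of_injOn (fun t => (ζ t, decide (ζ t = xs t))) ?_ ?_
    · intro t ht
      exact mem_coe.2 (mem_product.2 ⟨(hζ t ht).1, mem_univ _⟩)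
    · have key : ∀ t ∈ {t ∈ range T | ¬ (p (xs t) ↔ p (xs (t + 1)))},
          ∀ t' ∈ {t ∈ range T | ¬ (p (xs t) ↔ p (xs (t + 1)))}, t < t' → ζ t = ζ t' →
          ζ t ≠ xs t ∧ ζ t' = xs t' := by
        intro t ht t' ht' hlt he
        obtain ⟨-, h1, h2⟩ := hζ t ht
        obtain ⟨-, h3, h4⟩ := hζ t' ht'
        have h5 : xs (t + 1) ≤ xs t' := hxs hlt
        refine ⟨fun h => (mem_filter.1 ht).2 ?_, by linarith⟩
        rw [show xs (t + 1) = xs t by linarith]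
      intro t ht t' ht' he
      simp only [Prod.mk.injEq, decide_eq_decide] at he
      rcases lt_trichotomy t t' with h | h | h
      · have := key t ht t' ht' h he.1
        tauto
      · exact h
      · have := key t' ht' t ht h he.1.symm
        tauto
  rw [card_product, Finset.card_univ, Fintype.card_bool] at this
  omega

lemma exists_monotone_enumeration (X : Finset ℝ) :
    ∃ (xs : ℕ → ℝ) (T : ℕ) (τ : ℝ → ℕ), Monotone xs ∧ ∀ x ∈ X, τ x ≤ T ∧ xs (τ x) = x := by
  rcases X.eq_empty_or_nonempty with rfl | hne
  · exact ⟨fun _ => 0, 0, fun _ => 0, monotone_const, by simp⟩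
  obtain ⟨n, hn⟩ : ∃ n, #X = n + 1 := ⟨#X - 1, by have := hne.card_pos; omega⟩
  have h : ∀ x ∈ X, ∃ t ≤ n, X.orderEmbOfFin hn ⟨min t n, by omega⟩ = x := by
    intro x hx
    have : x ∈ Set.range (X.orderEmbOfFin hn) := by
      rw [Finset.range_orderEmbOfFin]; exact hx
    obtain ⟨i, hi⟩ := this
    refine ⟨i, by omega, ?_⟩
    rw [← hi]
    congr 1
    ext
    simp only
    omega
  choose! τ hτ using h
  refine ⟨fun t => X.orderEmbOfFin hn ⟨min t n, by omega⟩, n, τ, fun t t' h => ?_, hτ⟩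
  refine (X.orderEmbOfFin hn).monotone ?_
  rw [Fin.mk_le_mk]
  omega

lemma exists_gt_forall_le_iff_lt (S : Finset ℝ) (c : ℝ) :
    ∃ c' > c, ∀ s ∈ S, (s ≤ c ↔ s < c') := by
  induction S using Finset.induction_on with
  | empty => exact ⟨c + 1, by linarith, by simp⟩
  | insert a S _ ih =>
    obtain ⟨c', hc, h⟩ := ih
    rcases le_or_gt a c with ha | ha
    · refine ⟨c', hc, fun s hs => ?_⟩
      rcases mem_insert.1 hs with rfl | hs
      · exact ⟨fun _ => by linarith, fun _ => ha⟩
      · exact h s hs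
    · refine ⟨min a c', lt_min ha hc, fun s hs => ?_⟩
      rcases mem_insert.1 hs with rfl | hs
      · exact ⟨fun h => by linarith, fun h => absurd (lt_of_lt_of_le h (min_le_left _ _))
          (lt_irrefl _)⟩
      · exact ⟨fun h' => lt_min (by linarith) ((h s hs).1 h'),
          fun h' => (h s hs).2 (lt_of_lt_of_le h' (min_le_right _ _))⟩

lemma dist_lt_iff_arcs (a b : Pt) {R : ℝ} (hR : 0 < R) :
    dist a b < R ↔ circArc (b 0) (b 1) R (-1) (a 0) < a 1 ∧ ¬ circArc (b 0) (b 1) R 1 (a 0) ≤ a 1 := by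
  rw [EuclideanSpace.dist_eq, Real.sqrt_lt' hR, Fin.sum_univ_two, Real.dist_eq, Real.dist_eq,
    sq_abs]
  have h : |a 1 - b 1| < √(R ^ 2 - (a 0 - b 0) ^ 2) ↔
      |a 1 - b 1| ^ 2 < R ^ 2 - (a 0 - b 0) ^ 2 := Real.lt_sqrt (abs_nonneg _)
  rw [← lt_sub_iff_add_lt', ← h, abs_lt, circArc, circArc, not_le]
  constructor <;> rintro ⟨h1, h2⟩ <;> constructor <;> linarith

open Classical in
/-- A hierarchical cutting for annuli: nested labels such that each class at depth `d` is split by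
few annuli. -/
theorem exists_nested_labels_annuli (A B : Finset Pt) (α β : ℝ) (hα : 0 ≤ α) (hαβ : α < β) (E : ℕ)
    (hB : #B ≤ 2 ^ E) :
    ∃ L : ℕ → Pt → ℕ × ℕ,
      (∀ d d', d' ≤ d → d ≤ E → ∀ a a', L d a = L d a' → L d' a = L d' a') ∧
      (∀ d ≤ E, #(A.image (L d)) ≤ 83 * 4 ^ d) ∧
      ∀ d ≤ E, ∀ v, #{b ∈ B | ∃ a ∈ A, ∃ a' ∈ A, L d a = v ∧ L d a' = v ∧
        dist a b ∈ Set.Ioc α β ∧ dist a' b ∉ Set.Ioc α β} ≤ 8 * 2 ^ (E - d) := by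
  obtain ⟨xs, T, τ, hxs, hτ⟩ := exists_monotone_enumeration (A.image fun a => a 0)
  set D : Finset ℝ := (A ×ˢ B).image fun p => dist p.1 p.2 with hD
  obtain ⟨α', hα', hα''⟩ := exists_gt_forall_le_iff_lt D α
  obtain ⟨β', hβ', hβ''⟩ := exists_gt_forall_le_iff_lt D β
  have hα0 : 0 < α' := by linarith
  have hβ0 : 0 < β' := by linarith
  let R : Bool → ℝ := fun u => if u then α' else β'
  obtain ⟨ε, hε, hε'⟩ := exists_gt_forall_le_iff_lt
    ((A ×ˢ (B ×ˢ (univ : Finset Bool))).image fun p =>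
      circArc (p.2.1 0) (p.2.1 1) (R p.2.2) 1 (p.1 0) - p.1 1) 0
  let F : (B × Bool × Bool) → ℕ → ℝ := fun i t =>
    circArc (i.1.1 0) (i.1.1 1 - if i.2.2 then ε else 0) (R i.2.1) (if i.2.2 then 1 else -1) (xs t)
  have hs : ∀ i j, #{t ∈ range T | ¬ (F i t ≤ F j t ↔ F i (t + 1) ≤ F j (t + 1))} ≤ 20 := by
    intro i j
    obtain ⟨Z, hZ, hz⟩ := circArc_breakpoints (i.1.1 0) (i.1.1 1 - if i.2.2 then ε else 0)
      (R i.2.1) (if i.2.2 then 1 else -1) (j.1.1 0) (j.1.1 1 - if j.2.2 then ε else 0)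
      (R j.2.1) (if j.2.2 then 1 else -1) (by split_ifs <;> norm_num) (by split_ifs <;> norm_num)
    have := card_changes_le Z hz hxs T
    exact this.trans (by omega)
  have hcard : Fintype.card (B × Bool × Bool) ≤ 2 ^ (E + 2) := by
    simp only [Fintype.card_prod, Fintype.card_coe, Fintype.card_bool, pow_succ]
    omega
  obtain ⟨L, hL1, hL2, hL3⟩ := exists_nested_labels F T 20 (E + 2) hcard hs A
    (fun a => τ (a 0)) (fun a => a 1) (fun a ha => (hτ _ (mem_image_of_mem _ ha)).1)
  refine ⟨L, fun d d' h hd => hL1 d d' h (by omega), fun d hd => hL2 d (by omega),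
    fun d hd v => ?_⟩
  have h4 : 2 * 2 ^ (E + 2 - d) = 8 * 2 ^ (E - d) := by
    rw [show E + 2 - d = E - d + 2 by omega, pow_add]; ring
  rw [← h4]
  refine le_trans ?_ (hL3 d v)
  refine le_trans (Finset.card_le_card ?_) (Finset.card_image_le (f := fun i => i.1.1))
  intro b hb
  obtain ⟨hbB, a, ha, a', ha', hv, hv', h1, h2⟩ := mem_filter.1 hb
  by_contra hcon
  have hns : ∀ u w, F (⟨b, hbB⟩, u, w) (τ (a 0)) < a 1 ↔ F (⟨b, hbB⟩, u, w) (τ (a' 0)) < a' 1 := by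
    intro u w
    by_contra hne
    apply hcon
    simp only [mem_image, mem_filter, mem_univ, true_and]
    refine ⟨(⟨b, hbB⟩, u, w), ?_, rfl⟩
    by_cases h : F (⟨b, hbB⟩, u, w) (τ (a 0)) < a 1
    · exact ⟨a, ha, a', ha', hv, hv', h, fun h' => hne ⟨fun _ => h', fun _ => h⟩⟩
    · exact ⟨a', ha', a, ha, hv', hv, by_contra fun h' =>
        hne ⟨fun x => absurd x h, fun x => absurd x h'⟩, h⟩
  have hin : ∀ u, ∀ p ∈ A, dist p b < R u ↔ F (⟨b, hbB⟩, u, false) (τ (p 0)) < p 1 ∧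
      ¬ F (⟨b, hbB⟩, u, true) (τ (p 0)) < p 1 := by
    intro u p hp
    have hx := (hτ _ (mem_image_of_mem (fun a : Pt => a 0) hp)).2
    have hR : 0 < R u := by cases u <;> simp [R, hα0, hβ0]
    rw [dist_lt_iff_arcs p b hR]
    have h3 := hε' _ (mem_image_of_mem _ (mem_product.2 ⟨hp, mem_product.2 ⟨hbB, mem_univ u⟩⟩ :
      (p, b, u) ∈ A ×ˢ (B ×ˢ (univ : Finset Bool))))
    simp only [F, hx, if_true]
    simp only [Bool.false_eq_true, if_false, sub_zero]
    refine and_congr Iff.rfl (not_congr ?_)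
    rw [← sub_nonpos, h3]
    unfold circArc
    constructor <;> intro h <;> linarith
  have hrel : ∀ p ∈ A, dist p b ∈ Set.Ioc α β ↔ ¬ dist p b < α' ∧ dist p b < β' := by
    intro p hp
    have hm : dist p b ∈ D := by
      rw [hD, mem_image]
      exact ⟨(p, b), mem_product.2 ⟨hp, hbB⟩, rfl⟩
    rw [Set.mem_Ioc, ← hα'' _ hm, ← hβ'' _ hm, not_le]
  have e1 : dist a b < α' ↔ dist a' b < α' := by
    have x1 := hin true a ha
    have x2 := hin true a' ha'
    simp only [R, if_true] at x1 x2
    rw [x1, x2, hns, hns]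
  have e2 : dist a b < β' ↔ dist a' b < β' := by
    have x1 := hin false a ha
    have x2 := hin false a' ha'
    simp only [R, Bool.false_eq_true, if_false] at x1 x2
    rw [x1, x2, hns, hns]
  rw [hrel a ha] at h1
  rw [hrel a' ha', ← e1, ← e2] at h2
  exact h2 h1

lemma exists_chunks {α γ : Type*} [DecidableEq α] [DecidableEq γ] (A : Finset α) (f : α → γ)
    (M K : ℕ) (hM : 0 < M) (hA : #A ≤ M * K) :
    ∃ c : α → ℕ, #(A.image fun a => (f a, c a)) ≤ #(A.image f) + K ∧
      ∀ v j, #{a ∈ A | f a = v ∧ c a = j} ≤ M := by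
  have hidx : ∀ S : Finset α, ∃ e : α → ℕ, Set.InjOn e S ∧ ∀ a ∈ S, e a < #S := by
    intro S
    refine ⟨fun a => S.toList.idxOf a, fun a ha b _ h => ?_, fun a ha => ?_⟩
    · exact (List.idxOf_inj (by simpa using ha)).1 h
    · rw [← Finset.length_toList]
      exact List.idxOf_lt_length_iff.2 (by simpa using ha)
  choose e he1 he2 using hidx
  let S : γ → Finset α := fun v => {a ∈ A | f a = v}
  refine ⟨fun a => e (S (f a)) a / M, ?_, fun v j => ?_⟩
  · have hsub : (A.image fun a => (f a, e (S (f a)) a / M)) ⊆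
        (A.image f).biUnion fun v => (range (#(S v) / M + 1)).image fun j => (v, j) := by
      intro p hp
      obtain ⟨a, ha, rfl⟩ := mem_image.1 hp
      simp only [mem_biUnion, mem_image, mem_range, Prod.mk.injEq]
      exact ⟨f a, ⟨a, ha, rfl⟩, _, Nat.lt_succ_of_le
        (Nat.div_le_div_right (he2 (S (f a)) a (mem_filter.2 ⟨ha, rfl⟩)).le), rfl, rfl⟩
    refine (Finset.card_le_card hsub).trans (Finset.card_biUnion_le.trans ?_)
    refine (Finset.sum_le_sum fun v _ => Finset.card_image_le).trans ?_
    simp only [card_range, Finset.sum_add_distrib, sum_const, smul_eq_mul, mul_one]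
    rw [add_comm]
    refine Nat.add_le_add_left (Nat.le_of_mul_le_mul_left ?_ hM) _
    refine le_trans ?_ hA
    rw [Finset.card_eq_sum_card_image f A, Finset.mul_sum]
    exact Finset.sum_le_sum fun v _ => Nat.mul_div_le _ _
  · have : #{a ∈ A | f a = v ∧ e (S (f a)) a / M = j} ≤ #(Ico (j * M) ((j + 1) * M)) := by
      refine Finset.card_le_card_of_injOn (e (S v)) ?_ ?_
      · intro a ha
        obtain ⟨_, rfl, hj⟩ := mem_filter.1 ha
        rw [mem_coe, mem_Ico, ← hj]
        exact ⟨Nat.div_mul_le_self _ _, by rw [mul_comm]; exact Nat.lt_mul_div_succ _ hM⟩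
      · intro a ha b hb h
        obtain ⟨ha1, ha2, _⟩ := mem_filter.1 ha
        obtain ⟨hb1, hb2, _⟩ := mem_filter.1 hb
        exact he1 (S v) (mem_filter.2 ⟨ha1, ha2⟩) (mem_filter.2 ⟨hb1, hb2⟩) h
    rwa [Nat.card_Ico, add_mul, one_mul, Nat.add_sub_cancel_left] at this

/-- `IsPartialBRS` in terms of points: a pair of points lies in at most one of the bicliques in
`G ∪ P`, those in `G` only contain pairs with distance in `(α, β]`, and all such pairs are covered. -/
structure BicliqueCover (A B : Finset Pt) (α β : ℝ) (G P : Finset (Finset Pt × Finset Pt)) :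
    Prop where
  subset_left : ∀ p ∈ G, p.1 ⊆ A ∧ p.2 ⊆ B
  subset_right : ∀ p ∈ P, p.1 ⊆ A ∧ p.2 ⊆ B
  unique_left : ∀ p ∈ G, ∀ q ∈ G, ∀ a b, a ∈ p.1 → b ∈ p.2 → a ∈ q.1 → b ∈ q.2 → p = q
  unique_right : ∀ p ∈ P, ∀ q ∈ P, ∀ a b, a ∈ p.1 → b ∈ p.2 → a ∈ q.1 → b ∈ q.2 → p = q
  separate : ∀ p ∈ G, ∀ q ∈ P, ∀ a b, a ∈ p.1 → b ∈ p.2 → a ∈ q.1 → b ∈ q.2 → False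
  good : ∀ p ∈ G, ∀ a ∈ p.1, ∀ b ∈ p.2, dist a b ∈ Set.Ioc α β
  cover : ∀ a ∈ A, ∀ b ∈ B, dist a b ∈ Set.Ioc α β →
    (∃ p ∈ G, a ∈ p.1 ∧ b ∈ p.2) ∨ ∃ p ∈ P, a ∈ p.1 ∧ b ∈ p.2

lemma BicliqueCover.isPartialBRS {A B : Finset Pt} {α β : ℝ}
    {G P : Finset (Finset Pt × Finset Pt)} (h : BicliqueCover A B α β G P) :
    IsPartialBRS A B α β G P := by
  refine ⟨h.subset_left, h.subset_right, fun p hp q hq hne => ?_, fun p hp q hq hne => ?_,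
    fun p hp q hq => ?_, h.good, fun a ha b hb hab => ?_⟩
  · rw [Finset.disjoint_left]
    rintro ⟨a, b⟩ h1 h2
    rw [mem_product] at h1 h2
    exact hne (h.unique_left p hp q hq a b h1.1 h1.2 h2.1 h2.2)
  · rw [Finset.disjoint_left]
    rintro ⟨a, b⟩ h1 h2
    rw [mem_product] at h1 h2
    exact hne (h.unique_right p hp q hq a b h1.1 h1.2 h2.1 h2.2)
  · rw [Finset.disjoint_left]
    rintro ⟨a, b⟩ h1 h2
    rw [mem_product] at h1 h2
    exact h.separate p hp q hq a b h1.1 h1.2 h2.1 h2.2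
  · rcases h.cover a ha b hb hab with ⟨p, hp, h1, h2⟩ | ⟨p, hp, h1, h2⟩
    · exact Or.inl ⟨p, ⟨hp, h1, h2⟩, fun q hq =>
        h.unique_left q hq.1 p hp a b hq.2.1 hq.2.2 h1 h2⟩
    · exact Or.inr ⟨p, ⟨hp, h1, h2⟩, fun q hq =>
        h.unique_right q hq.1 p hp a b hq.2.1 hq.2.2 h1 h2⟩

open Classical in
/-- Replace each undecided biclique by a cover of it with the two sides exchanged. -/
lemma BicliqueCover.refine {A B : Finset Pt} {α β : ℝ} {G P : Finset (Finset Pt × Finset Pt)}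
    (h : BicliqueCover A B α β G P) (G' P' : Finset Pt × Finset Pt → Finset (Finset Pt × Finset Pt))
    (h' : ∀ p ∈ P, BicliqueCover p.2 p.1 α β (G' p) (P' p)) :
    BicliqueCover A B α β (G ∪ P.biUnion fun p => (G' p).image Prod.swap)
      (P.biUnion fun p => (P' p).image Prod.swap) where
  subset_left := by
    intro q hq
    rcases mem_union.1 hq with hq | hq
    · exact h.subset_left q hq
    · simp only [mem_biUnion, mem_image] at hq
      obtain ⟨p, hp, q, hq', rfl⟩ := hq
      exact ⟨((h' p hp).subset_left q hq').2.trans (h.subset_right p hp).1,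
        ((h' p hp).subset_left q hq').1.trans (h.subset_right p hp).2⟩
  subset_right := by
    intro q hq
    simp only [mem_biUnion, mem_image] at hq
    obtain ⟨p, hp, q, hq, rfl⟩ := hq
    exact ⟨((h' p hp).subset_right q hq).2.trans (h.subset_right p hp).1,
      ((h' p hp).subset_right q hq).1.trans (h.subset_right p hp).2⟩
  unique_left := by
    intro q hq q' hq' a b h1 h2 h3 h4
    simp only [mem_union, mem_biUnion, mem_image] at hq hq'
    rcases hq with hq | ⟨p, hp, q, hq, rfl⟩ <;> rcases hq' with hq' | ⟨p', hp', q', hq', rfl⟩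
    · exact h.unique_left q hq q' hq' a b h1 h2 h3 h4
    · have := (h' p' hp').subset_left q' hq'
      exact (h.separate q hq p' hp' a b h1 h2 (this.2 h3) (this.1 h4)).elim
    · have := (h' p hp).subset_left q hq
      exact (h.separate q' hq' p hp a b h3 h4 (this.2 h1) (this.1 h2)).elim
    · have s := (h' p hp).subset_left q hq
      have s' := (h' p' hp').subset_left q' hq'
      obtain rfl := h.unique_right p hp p' hp' a b (s.2 h1) (s.1 h2) (s'.2 h3) (s'.1 h4)
      rw [(h' p hp).unique_left q hq q' hq' b a h2 h1 h4 h3]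
  unique_right := by
    intro q hq q' hq' a b h1 h2 h3 h4
    simp only [mem_biUnion, mem_image] at hq hq'
    obtain ⟨p, hp, q, hq, rfl⟩ := hq
    obtain ⟨p', hp', q', hq', rfl⟩ := hq'
    have s := (h' p hp).subset_right q hq
    have s' := (h' p' hp').subset_right q' hq'
    obtain rfl := h.unique_right p hp p' hp' a b (s.2 h1) (s.1 h2) (s'.2 h3) (s'.1 h4)
    rw [(h' p hp).unique_right q hq q' hq' b a h2 h1 h4 h3]
  separate := by
    intro q hq q' hq' a b h1 h2 h3 h4
    simp only [mem_union, mem_biUnion, mem_image] at hq hq'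
    obtain ⟨p', hp', q', hq', rfl⟩ := hq'
    have s' := (h' p' hp').subset_right q' hq'
    rcases hq with hq | ⟨p, hp, q, hq, rfl⟩
    · exact h.separate q hq p' hp' a b h1 h2 (s'.2 h3) (s'.1 h4)
    · have s := (h' p hp).subset_left q hq
      obtain rfl := h.unique_right p hp p' hp' a b (s.2 h1) (s.1 h2) (s'.2 h3) (s'.1 h4)
      exact (h' p hp).separate q hq q' hq' b a h2 h1 h4 h3
  good := by
    intro q hq a ha b hb
    simp only [mem_union, mem_biUnion, mem_image] at hq
    rcases hq with hq | ⟨p, hp, q, hq, rfl⟩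
    · exact h.good q hq a ha b hb
    · rw [dist_comm]
      exact (h' p hp).good q hq b hb a ha
  cover := by
    intro a ha b hb hab
    simp only [mem_union, mem_biUnion, mem_image]
    rcases h.cover a ha b hb hab with ⟨p, hp, h1, h2⟩ | ⟨p, hp, h1, h2⟩
    · exact Or.inl ⟨p, Or.inl hp, h1, h2⟩
    · rw [dist_comm] at hab
      rcases (h' p hp).cover b h2 a h1 hab with ⟨q, hq, h3, h4⟩ | ⟨q, hq, h3, h4⟩
      · exact Or.inl ⟨q.swap, Or.inr ⟨p, hp, q, hq, rfl⟩, h4, h3⟩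
      · exact Or.inr ⟨q.swap, ⟨p, hp, q, hq, rfl⟩, h4, h3⟩

lemma sub_div_two_pow_add_le (D i : ℕ) (hi : i ≤ D.size) :
    D - D / 2 ^ i ≤ D - D.size + i := by
  rcases Nat.eq_zero_or_pos D with rfl | hD
  · simp
  rcases Nat.lt_or_ge i D.size with h | h
  · have h1 : 2 ^ (D.size - 1) ≤ D := Nat.lt_size.1 (by omega)
    have h2 : 2 ^ (D.size - 1 - i) ≤ D / 2 ^ i := by
      rw [Nat.le_div_iff_mul_le (by positivity), ← pow_add]
      rwa [show D.size - 1 - i + i = D.size - 1 by omega]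
    have h3 : D.size - 1 - i < 2 ^ (D.size - 1 - i) := Nat.lt_two_pow_self
    omega
  · exact (Nat.sub_le _ _).trans (by omega)

lemma sum_four_pow_le (D : ℕ) :
    ∑ i ∈ range (D.size + 1), 4 ^ (D - D / 2 ^ i) ≤ 2 * 4 ^ D := by
  have hk : D.size ≤ D := Nat.size_le.2 Nat.lt_two_pow_self
  calc _ ≤ ∑ i ∈ range (D.size + 1), 4 ^ (D - D.size) * 4 ^ i := by
        refine Finset.sum_le_sum fun i hi => ?_
        rw [← pow_add]
        exact Nat.pow_le_pow_right (by norm_num)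
          (sub_div_two_pow_add_le D i (by have := mem_range.1 hi; omega))
    _ = 4 ^ (D - D.size) * ∑ i ∈ range (D.size + 1), 4 ^ i := by rw [Finset.mul_sum]
    _ ≤ 4 ^ (D - D.size) * (2 * 4 ^ D.size) := by
        gcongr
        rw [Nat.geomSum_eq (by norm_num), pow_succ]
        omega
    _ = 2 * 4 ^ D := by
        rw [mul_left_comm, ← pow_add, Nat.sub_add_cancel hk]

lemma sum_image_le_sum_nat {α γ : Type*} [DecidableEq γ] (s : Finset α) (g : α → γ) (f : γ → ℕ) :
    ∑ p ∈ s.image g, f p ≤ ∑ a ∈ s, f (g a) := by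
  classical
  induction s using Finset.induction_on with
  | empty => simp
  | insert a s ha ih =>
    rw [image_insert, sum_insert ha]
    by_cases h : g a ∈ s.image g
    · rw [insert_eq_of_mem h]; omega
    · rw [sum_insert h]; omega

lemma sum_biUnion_le_sum_nat {α γ : Type*} [DecidableEq γ] (s : Finset α) (t : α → Finset γ)
    (f : γ → ℕ) : ∑ p ∈ s.biUnion t, f p ≤ ∑ a ∈ s, ∑ p ∈ t a, f p := by
  classical
  induction s using Finset.induction_on with
  | empty => simp
  | insert a s ha ih =>
    rw [biUnion_insert, sum_insert ha]
    have := Finset.sum_union_inter (s₁ := t a) (s₂ := s.biUnion t) (f := f)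
    omega

/-- Descend the nested labels through the depths `D - D / 2 ^ i`, recording an annulus the first
time it contains the whole class of a point. -/
theorem exists_bicliqueCover_one_sided (A B : Finset Pt) (α β : ℝ) (hα : 0 ≤ α) (hαβ : α < β)
    (E D M : ℕ) (hB : #B ≤ 2 ^ E) (hD : D ≤ E) (hM : 0 < M) (hA : #A ≤ M * 4 ^ D) :
    ∃ G P, BicliqueCover A B α β G P ∧ #G ≤ 166 * 4 ^ D ∧
      ∑ p ∈ G, #p.1 ≤ (D.size + 1) * #A ∧
      ∑ p ∈ G, #p.2 ≤ (D.size + 1) * (1328 * 2 ^ (D + E)) ∧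
      #P ≤ 84 * 4 ^ D ∧ ∀ p ∈ P, #p.1 ≤ M ∧ #p.2 ≤ 8 * 2 ^ (E - D) := by
  classical
  obtain ⟨L, hnest, hcount, hsplit⟩ := exists_nested_labels_annuli A B α β hα hαβ E hB
  let rel : Pt → Pt → Prop := fun a b => dist a b ∈ Set.Ioc α β
  let split : ℕ → Pt → Pt → Prop := fun d a b =>
    ∃ a' ∈ A, ∃ a'' ∈ A, L d a' = L d a ∧ L d a'' = L d a ∧ rel a' b ∧ ¬ rel a'' b
  let δ : ℕ → ℕ := fun i => D - D / 2 ^ i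
  set k := D.size
  have hδD : ∀ i, δ i ≤ D := fun i => Nat.sub_le _ _
  have hδk : δ k = D := by
    simp only [δ, k]
    rw [Nat.div_eq_of_lt (Nat.size_le.1 le_rfl), Nat.sub_zero]
  have hδ : Monotone δ := fun i j h =>
    Nat.sub_le_sub_left (Nat.div_le_div_left (Nat.pow_le_pow_right (by norm_num) h)
      (by positivity)) D
  have split_mono : ∀ d d' a b, d' ≤ d → d ≤ D → split d a b → split d' a b := by
    rintro d d' a b h hd ⟨a', ha', a'', ha'', h1, h2, h3, h4⟩
    exact ⟨a', ha', a'', ha'', hnest d d' h (by omega) _ _ h1, hnest d d' h (by omega) _ _ h2,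
      h3, h4⟩
  have split_congr : ∀ d a a' b, L d a = L d a' → split d a b → split d a' b := by
    rintro d a a' b h ⟨u, hu, u', hu', h1, h2, h3, h4⟩
    exact ⟨u, hu, u', hu', h1.trans h, h2.trans h, h3, h4⟩
  have split_card : ∀ d ≤ D, ∀ a, #{b ∈ B | split d a b} ≤ 8 * 2 ^ (E - d) := by
    intro d hd a
    refine le_trans (Finset.card_le_card fun b hb => ?_) (hsplit d (by omega) (L d a))
    obtain ⟨hb, a', ha', a'', ha'', h1, h2, h3, h4⟩ := mem_filter.1 hb
    exact mem_filter.2 ⟨hb, a', ha', a'', ha'', h1, h2, h3, h4⟩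
  let cls : ℕ → ℕ × ℕ → Finset Pt := fun i v => {a ∈ A | L (δ i) a = v}
  let BS : ℕ → ℕ × ℕ → Finset Pt := fun i v => {b ∈ B | ∀ a ∈ A, L (δ i) a = v →
    (i = 0 ∨ split (δ (i - 1)) a b) ∧ ¬ split (δ i) a b ∧ rel a b}
  let V : ℕ → Finset (ℕ × ℕ) := fun i => A.image (L (δ i))
  let G : Finset (Finset Pt × Finset Pt) :=
    (range (k + 1)).biUnion fun i => (V i).image fun v => (cls i v, BS i v)
  obtain ⟨c, hc1, hc2⟩ := exists_chunks A (L D) M (4 ^ D) hM hA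
  let W : Finset ((ℕ × ℕ) × ℕ) := A.image fun a => (L D a, c a)
  let P : Finset (Finset Pt × Finset Pt) := W.image fun w =>
    ({a ∈ A | L D a = w.1 ∧ c a = w.2}, {b ∈ B | ∃ a ∈ A, L D a = w.1 ∧ split D a b})
  have hG : ∀ p ∈ G, ∃ i ≤ k, ∃ v, p = (cls i v, BS i v) := by
    intro p hp
    simp only [G, mem_biUnion, mem_image, mem_range] at hp
    obtain ⟨i, hi, v, -, rfl⟩ := hp
    exact ⟨i, by omega, v, rfl⟩
  have hGmem : ∀ i v a b, a ∈ cls i v → b ∈ BS i v → v = L (δ i) a ∧ a ∈ A ∧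
      (i = 0 ∨ split (δ (i - 1)) a b) ∧ ¬ split (δ i) a b ∧ rel a b := by
    intro i v a b ha hb
    obtain ⟨ha, hv⟩ := mem_filter.1 ha
    exact ⟨hv.symm, ha, (mem_filter.1 hb).2 a ha hv⟩
  have hP : ∀ p ∈ P, p.1 ⊆ A ∧ p.2 ⊆ B ∧ ∀ a ∈ p.1, ∀ b ∈ p.2, split D a b ∧
      p = ({x ∈ A | L D x = L D a ∧ c x = c a}, {b ∈ B | ∃ x ∈ A, L D x = L D a ∧ split D x b}) := by
    intro p hp
    obtain ⟨w, -, rfl⟩ := mem_image.1 hp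
    refine ⟨filter_subset _ _, filter_subset _ _, fun a ha b hb => ?_⟩
    obtain ⟨ha, hw1, hw2⟩ := mem_filter.1 ha
    obtain ⟨hb, a', ha', hw', hs⟩ := mem_filter.1 hb
    refine ⟨split_congr D a' a b (hw'.trans hw1.symm) hs, ?_⟩
    rw [hw1, hw2]
  refine ⟨G, P, ⟨?_, fun p hp => ⟨(hP p hp).1, (hP p hp).2.1⟩, ?_, ?_, ?_, ?_, ?_⟩,
    ?_, ?_, ?_, ?_, ?_⟩
  · intro p hp
    obtain ⟨i, -, v, rfl⟩ := hG p hp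
    exact ⟨filter_subset _ _, filter_subset _ _⟩
  · have key : ∀ i j a b, i < j → j ≤ k → split (δ (j - 1)) a b → split (δ i) a b :=
      fun i j a b hij _ h => split_mono _ _ a b (hδ (by omega)) (hδD _) h
    intro p hp q hq a b h1 h2 h3 h4
    obtain ⟨i, hi, v, rfl⟩ := hG p hp
    obtain ⟨j, hj, w, rfl⟩ := hG q hq
    obtain ⟨rfl, -, e1, e2, -⟩ := hGmem i v a b h1 h2
    obtain ⟨rfl, -, e3, e4, -⟩ := hGmem j w a b h3 h4
    rcases lt_trichotomy i j with h | rfl | h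
    · exact absurd (key i j a b h hj (e3.resolve_left (by omega))) e2
    · rfl
    · exact absurd (key j i a b h hi (e1.resolve_left (by omega))) e4
  · intro p hp q hq a b h1 h2 h3 h4
    rw [((hP p hp).2.2 a h1 b h2).2, ((hP q hq).2.2 a h3 b h4).2]
  · intro p hp q hq a b h1 h2 h3 h4
    obtain ⟨i, hi, v, rfl⟩ := hG p hp
    obtain ⟨rfl, -, e1, e2, -⟩ := hGmem i v a b h1 h2
    exact e2 (split_mono D (δ i) a b (hδD i) le_rfl ((hP q hq).2.2 a h3 b h4).1)
  · intro p hp a ha b hb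
    obtain ⟨i, hi, v, rfl⟩ := hG p hp
    exact (hGmem i v a b ha hb).2.2.2.2
  · intro a ha b hb hab
    by_cases hs : split D a b
    · right
      exact ⟨_, mem_image_of_mem _ (mem_image_of_mem (fun a => (L D a, c a)) ha),
        mem_filter.2 ⟨ha, rfl, rfl⟩, mem_filter.2 ⟨hb, a, ha, rfl, hs⟩⟩
    · left
      have hex : ∃ i, ¬ split (δ i) a b := ⟨k, by rwa [hδk]⟩
      set i := Nat.find hex with hi
      have hik : i ≤ k := Nat.find_min' hex (by rwa [hδk])
      have his : ¬ split (δ i) a b := Nat.find_spec hex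
      refine ⟨(cls i (L (δ i) a), BS i (L (δ i) a)), ?_, mem_filter.2 ⟨ha, rfl⟩,
        mem_filter.2 ⟨hb, fun a' ha' he => ⟨?_, ?_, ?_⟩⟩⟩
      · simp only [G, mem_biUnion, mem_range]
        exact ⟨i, by omega, mem_image_of_mem (fun v => (cls i v, BS i v))
          (mem_image_of_mem _ ha)⟩
      · rcases Nat.eq_zero_or_pos i with h0 | h0
        · exact Or.inl h0
        · right
          have := Nat.find_min hex (m := i - 1) (by omega)
          rw [not_not] at this
          exact split_congr _ a a' b (hnest _ _ (hδ (Nat.sub_le _ _))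
            ((hδD i).trans hD) _ _ he.symm) this
      · exact fun h => his (split_congr _ a' a b he h)
      · by_contra hr
        exact his ⟨a, ha, a', ha', rfl, he, hab, hr⟩
  · refine Finset.card_biUnion_le.trans ?_
    calc _ ≤ ∑ i ∈ range (k + 1), 83 * 4 ^ (D - D / 2 ^ i) :=
          Finset.sum_le_sum fun i _ => Finset.card_image_le.trans (hcount _ ((hδD i).trans hD))
      _ ≤ 83 * (2 * 4 ^ D) := by
          rw [← Finset.mul_sum]
          exact Nat.mul_le_mul_left _ (sum_four_pow_le D)
      _ = _ := by ring
  · refine (sum_biUnion_le_sum_nat _ _ _).trans ?_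
    calc _ ≤ ∑ i ∈ range (k + 1), #A := by
          refine Finset.sum_le_sum fun i _ => (sum_image_le_sum_nat _ _ _).trans ?_
          rw [Finset.card_eq_sum_card_image (L (δ i)) A]
      _ = _ := by simp
  · refine (sum_biUnion_le_sum_nat _ _ _).trans ?_
    have hlevel : ∀ i ∈ range (k + 1), ∑ p ∈ (V i).image (fun v => (cls i v, BS i v)), #p.2 ≤
        1328 * 2 ^ (D + E) := by
      intro i _
      refine (sum_image_le_sum_nat _ _ _).trans ?_
      have hV : #(V i) ≤ 83 * 4 ^ (δ i) := hcount _ ((hδD i).trans hD)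
      rcases Nat.eq_zero_or_pos i with rfl | hi
      · have h0 : δ 0 = 0 := by simp [δ]
        rw [h0, pow_zero, mul_one] at hV
        have h1 : ∀ v ∈ V 0, #(BS 0 v) ≤ 2 ^ E := fun v _ => (card_filter_le _ _).trans hB
        have h2 := Finset.sum_le_card_nsmul _ _ _ h1
        have h3 : 2 ^ E ≤ 2 ^ (D + E) := Nat.pow_le_pow_right (by norm_num) (by omega)
        rw [smul_eq_mul] at h2
        have h4 : #(V 0) * 2 ^ E ≤ 83 * 2 ^ (D + E) := Nat.mul_le_mul hV h3
        refine h2.trans (h4.trans ?_)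
        exact Nat.mul_le_mul_right _ (by norm_num)
      · have h1 : ∀ v ∈ V i, #(BS i v) ≤ 8 * 2 ^ (E - δ (i - 1)) := by
          intro v hv
          obtain ⟨a, ha, rfl⟩ := mem_image.1 hv
          refine le_trans (Finset.card_le_card fun b hb => ?_) (split_card _ (hδD _) a)
          obtain ⟨hb, h⟩ := mem_filter.1 hb
          exact mem_filter.2 ⟨hb, ((h a ha rfl).1).resolve_left (by omega)⟩
        have h2 := Finset.sum_le_card_nsmul _ _ _ h1
        rw [smul_eq_mul] at h2
        refine h2.trans ((Nat.mul_le_mul_right _ hV).trans ?_)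
        have h3 : δ i + δ i + (E - δ (i - 1)) ≤ D + E + 1 := by
          have e1 : D / 2 ^ i = D / 2 ^ (i - 1) / 2 := by
            rw [Nat.div_div_eq_div_mul, ← pow_succ]
            congr 2
            omega
          have e2 : D / 2 ^ (i - 1) ≤ D := Nat.div_le_self _ _
          simp only [δ]
          rw [e1]
          generalize D / 2 ^ (i - 1) = x at e2
          omega
        calc 83 * 4 ^ δ i * (8 * 2 ^ (E - δ (i - 1)))
            = 664 * 2 ^ (δ i + δ i + (E - δ (i - 1))) := by
              rw [show (4 : ℕ) = 2 * 2 by norm_num, mul_pow, pow_add, pow_add]; ring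
          _ ≤ 664 * 2 ^ (D + E + 1) :=
              Nat.mul_le_mul_left _ (Nat.pow_le_pow_right (by norm_num) h3)
          _ = _ := by rw [pow_succ]; ring
    refine (Finset.sum_le_sum hlevel).trans ?_
    simp
  · refine Finset.card_image_le.trans (hc1.trans ?_)
    have := hcount D hD
    omega
  · intro p hp
    obtain ⟨w, hw, rfl⟩ := mem_image.1 hp
    refine ⟨hc2 _ _, ?_⟩
    obtain ⟨a, ha, rfl⟩ := mem_image.1 hw
    refine le_trans (Finset.card_le_card fun b hb => ?_) (split_card D le_rfl a)
    obtain ⟨hb, a', ha', h, hs⟩ := mem_filter.1 hb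
    exact mem_filter.2 ⟨hb, split_congr D a' a b h hs⟩

open Classical in
/-- Apply the one-sided decomposition twice, the second time with points and annuli exchanged. -/
theorem exists_bicliqueCover_two_sided (P : Finset Pt) (α β : ℝ) (hα : 0 ≤ α) (hαβ : α < β)
    (E D : ℕ) (hP : #P ≤ 2 ^ E) (hD : 3 * D ≤ E) :
    ∃ G R, BicliqueCover P P α β G R ∧ #G ≤ 10 ^ 6 * 16 ^ D ∧
      ∑ p ∈ G, #p.1 ≤ 10 ^ 6 * ((D.size + 1) * 2 ^ (E + D)) ∧
      ∑ p ∈ G, #p.2 ≤ 10 ^ 6 * ((D.size + 1) * 2 ^ (E + D)) ∧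
      #R ≤ 10 ^ 6 * 16 ^ D ∧
      ∀ p ∈ R, #p.1 ≤ 8 * 2 ^ (E - 3 * D) ∧ #p.2 ≤ 8 * 2 ^ (E - 3 * D) := by
  have h4 : (4 : ℕ) ^ D = 2 ^ (2 * D) := by rw [pow_mul]; norm_num
  obtain ⟨G₁, P₁, hcov, hG, hG1, hG2, hPc, hPs⟩ := exists_bicliqueCover_one_sided P P α β hα hαβ
    E D (2 ^ (E - 2 * D)) hP (by omega) (by positivity) (by
      rw [h4, ← pow_add, Nat.sub_add_cancel (by omega)]; exact hP)
  have hsecond : ∀ p ∈ P₁, ∃ G R, BicliqueCover p.2 p.1 α β G R ∧ #G ≤ 166 * 4 ^ D ∧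
      ∑ q ∈ G, #q.1 ≤ (D.size + 1) * (8 * 2 ^ (E - D)) ∧
      ∑ q ∈ G, #q.2 ≤ (D.size + 1) * (1328 * 2 ^ (E - D)) ∧
      #R ≤ 84 * 4 ^ D ∧
      ∀ q ∈ R, #q.1 ≤ 8 * 2 ^ (E - 3 * D) ∧ #q.2 ≤ 8 * 2 ^ (E - 3 * D) := by
    intro p hp
    obtain ⟨G, R, h1, h2, h3, h5, h6, h7⟩ := exists_bicliqueCover_one_sided p.2 p.1 α β hα hαβ
      (E - 2 * D) D (8 * 2 ^ (E - 3 * D)) (hPs p hp).1 (by omega) (by positivity) (by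
        rw [h4, mul_assoc, ← pow_add, show E - 3 * D + 2 * D = E - D by omega]
        exact (hPs p hp).2)
    rw [show D + (E - 2 * D) = E - D by omega] at h5
    rw [show E - 2 * D - D = E - 3 * D by omega] at h7
    exact ⟨G, R, h1, h2, h3.trans (Nat.mul_le_mul_left _ (hPs p hp).2), h5, h6, h7⟩
  choose! G₂ R₂ h1 h2 h3 h5 h6 h7 using hsecond
  have hsum : ∀ (f : Finset Pt × Finset Pt → ℕ) (N : ℕ), (∀ p ∈ P₁, f p ≤ N) →
      ∑ p ∈ P₁, f p ≤ 84 * 4 ^ D * N := fun f N h => by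
    have := Finset.sum_le_card_nsmul _ _ _ h
    rw [smul_eq_mul] at this
    exact this.trans (Nat.mul_le_mul_right _ hPc)
  have h16 : 4 ^ D * 4 ^ D = 16 ^ D := by rw [← mul_pow]; norm_num
  have h416 : 4 ^ D ≤ 16 ^ D := Nat.pow_le_pow_left (by norm_num) D
  have hED : 4 ^ D * 2 ^ (E - D) = 2 ^ (E + D) := by
    rw [h4, ← pow_add]; congr 1; omega
  have hE : 2 ^ E ≤ 2 ^ (E + D) := Nat.pow_le_pow_right (by norm_num) (by omega)
  refine ⟨_, _, hcov.refine G₂ R₂ h1, ?_, ?_, ?_, ?_, ?_⟩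
  · have := hsum _ _ fun p hp => (card_image_le (s := G₂ p) (f := Prod.swap)).trans (h2 p hp)
    refine (card_union_le _ _).trans ((Nat.add_le_add hG (card_biUnion_le.trans this)).trans ?_)
    calc 166 * 4 ^ D + 84 * 4 ^ D * (166 * 4 ^ D) = 166 * 4 ^ D + 13944 * (4 ^ D * 4 ^ D) := by ring
      _ ≤ _ := by rw [h16]; omega
  · have := hsum _ _ fun p hp =>
      (sum_image_le_sum_nat (G₂ p) Prod.swap fun q => #q.1).trans (h5 p hp)
    refine (le_trans (Nat.le_of_add_right_le (Finset.sum_union_inter).le)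
      (Nat.add_le_add hG1 ((sum_biUnion_le_sum_nat _ _ _).trans this))).trans ?_
    calc (D.size + 1) * #P + 84 * 4 ^ D * ((D.size + 1) * (1328 * 2 ^ (E - D)))
        = (D.size + 1) * #P + 111552 * ((D.size + 1) * (4 ^ D * 2 ^ (E - D))) := by ring
      _ ≤ (D.size + 1) * 2 ^ (E + D) + 111552 * ((D.size + 1) * 2 ^ (E + D)) := by
          rw [hED]
          exact Nat.add_le_add_right (Nat.mul_le_mul_left _ (hP.trans hE)) _
      _ ≤ _ := by omega
  · have := hsum _ _ fun p hp =>
      (sum_image_le_sum_nat (G₂ p) Prod.swap fun q => #q.2).trans (h3 p hp)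
    refine (le_trans (Nat.le_of_add_right_le (Finset.sum_union_inter).le)
      (Nat.add_le_add hG2 ((sum_biUnion_le_sum_nat _ _ _).trans this))).trans ?_
    calc (D.size + 1) * (1328 * 2 ^ (D + E)) + 84 * 4 ^ D * ((D.size + 1) * (8 * 2 ^ (E - D)))
        = 1328 * ((D.size + 1) * 2 ^ (E + D)) +
          672 * ((D.size + 1) * (4 ^ D * 2 ^ (E - D))) := by rw [add_comm D E]; ring
      _ ≤ _ := by rw [hED]; omega
  · have := hsum _ _ fun p hp => (card_image_le (s := R₂ p) (f := Prod.swap)).trans (h6 p hp)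
    refine (card_biUnion_le.trans this).trans ?_
    calc 84 * 4 ^ D * (84 * 4 ^ D) = 7056 * (4 ^ D * 4 ^ D) := by ring
      _ ≤ _ := by rw [h16]; omega
  · intro q hq
    simp only [mem_biUnion, mem_image] at hq
    obtain ⟨p, hp, q, hq, rfl⟩ := hq
    exact ⟨(h7 p hp q hq).2, (h7 p hp q hq).1⟩

lemma one_le_logb_logb {x : ℝ} (hx : 2 ^ 12 ≤ x) : 1 ≤ Real.logb 2 (Real.logb 2 x) := by
  have hu : 12 ≤ Real.logb 2 x := by
    rw [Real.le_logb_iff_rpow_le (by norm_num) (by linarith)]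
    exact_mod_cast hx
  rw [Real.le_logb_iff_rpow_le (by norm_num) (by linarith)]
  norm_num
  linarith

lemma logb_logb_le_rpow {x : ℝ} (hx : 2 ^ 12 ≤ x) :
    Real.logb 2 (Real.logb 2 x) ≤ x ^ ((1 : ℝ) / 3) := by
  have hx0 : 0 < x := by linarith
  have hu : 12 ≤ Real.logb 2 x := by
    rw [Real.le_logb_iff_rpow_le (by norm_num) hx0]
    exact_mod_cast hx
  have hl1 := Real.log_two_gt_d9
  have hl2 := Real.log_two_lt_d9
  have hxu : Real.log x = Real.logb 2 x * Real.log 2 := by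
    rw [Real.logb, div_mul_cancel₀ _ (by linarith)]
  set u := Real.logb 2 x
  set l := Real.log 2
  have h1 : Real.log u ≤ u / 8 - 1 + 3 * l := by
    have h := Real.log_le_sub_one_of_pos (x := u / 8) (by linarith)
    rw [Real.log_div (by linarith) (by norm_num),
      show (8 : ℝ) = 2 ^ 3 by norm_num, Real.log_pow] at h
    push_cast at h
    linarith
  have h2 : u * l / 3 + 1 ≤ x ^ ((1 : ℝ) / 3) := by
    rw [Real.rpow_def_of_pos hx0, hxu]
    refine le_trans (le_of_eq ?_) (Real.add_one_le_exp _)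
    ring
  refine le_trans ?_ h2
  rw [Real.logb, div_le_iff₀ (by linarith)]
  have h3 : (0.48 : ℝ) ≤ l * l := by nlinarith
  nlinarith

/-- The depth at which the recursion of the two-sided decomposition stops. -/
lemma exists_depth {n : ℕ} (hn : 2 ^ 12 ≤ n) {N LL : ℝ} (hN : N = (n : ℝ) ^ ((1 : ℝ) / 3))
    (hLL : LL = Real.logb 2 (Real.logb 2 (n : ℝ))) :
    ∃ E D : ℕ, n ≤ 2 ^ E ∧ 3 * D ≤ E ∧ (16 : ℝ) ^ D ≤ N ^ 4 / LL ^ 4 ∧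
      ((D.size + 1 : ℕ) : ℝ) * 2 ^ (E + D) ≤ 6 * N ^ 4 ∧
      (8 : ℝ) * 2 ^ (E - 3 * D) ≤ 128 * LL ^ 3 := by
  have hnR : (2 : ℝ) ^ 12 ≤ n := by exact_mod_cast hn
  have hn0 : (0 : ℝ) < n := by linarith
  have hL1 : 1 ≤ LL := hLL ▸ one_le_logb_logb hnR
  have hLN : LL ≤ N := by rw [hLL, hN]; exact logb_logb_le_rpow hnR
  have hL0 : 0 < LL := by linarith
  have hN0 : 0 < N := by linarith
  have hN3 : N ^ 3 = n := by
    rw [hN, ← Real.rpow_natCast, ← Real.rpow_mul hn0.le]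
    norm_num
  obtain ⟨D, hD1, hD2⟩ := exists_nat_pow_near (x := N / LL) (y := (2 : ℝ))
    ((one_le_div hL0).2 hLN) (by norm_num)
  have hDN : (2 : ℝ) ^ D ≤ N := hD1.trans (div_le_self hN0.le hL1)
  have hD3 : ((2 : ℝ) ^ D) ^ 3 ≤ n := by
    rw [← hN3]
    gcongr
  have hE1 : n ≤ 2 ^ Nat.clog 2 n := Nat.le_pow_clog (by norm_num) n
  have hE2 : (2 : ℝ) ^ Nat.clog 2 n ≤ 2 * n := by
    have h := Nat.pow_pred_clog_lt_self (b := 2) (by norm_num) (x := n) (by omega)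
    have hpos : 0 < Nat.clog 2 n := Nat.clog_pos (by norm_num) (by omega)
    have h' : 2 ^ Nat.clog 2 n ≤ 2 * n := by
      rw [← Nat.sub_add_cancel hpos, pow_succ]
      simp only [Nat.pred_eq_sub_one, Nat.succ_eq_add_one, zero_add] at h ⊢
      omega
    exact_mod_cast h'
  generalize Nat.clog 2 n = E at hE1 hE2
  have hDE : 3 * D ≤ E := by
    have h : (2 : ℕ) ^ (3 * D) ≤ 2 ^ E := by
      refine le_trans ?_ hE1
      rw [mul_comm, pow_mul]
      exact_mod_cast hD3
    exact (Nat.pow_le_pow_iff_right (by norm_num)).1 h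
  have hsize : ((D.size + 1 : ℕ) : ℝ) ≤ 3 * LL := by
    rcases Nat.eq_zero_or_pos D with rfl | hpos
    · simp
      linarith
    · have hs : 0 < D.size := Nat.size_pos.2 hpos
      have h1 : 2 ^ (D.size - 1) ≤ D := Nat.lt_size.1 (by omega)
      have h2 : (D : ℝ) ≤ Real.logb 2 n := by
        rw [Real.le_logb_iff_rpow_le (by norm_num) hn0, Real.rpow_natCast]
        refine le_trans ?_ hD3
        exact le_self_pow₀ (one_le_pow₀ (by norm_num)) (by norm_num)
      have h3 : ((D.size - 1 : ℕ) : ℝ) ≤ LL := by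
        rw [hLL, Real.le_logb_iff_rpow_le (by norm_num)
          (lt_of_lt_of_le (by exact_mod_cast hpos) h2), Real.rpow_natCast]
        refine le_trans ?_ h2
        exact_mod_cast h1
      have h4 : ((D.size + 1 : ℕ) : ℝ) = ((D.size - 1 : ℕ) : ℝ) + 2 := by
        rw [show D.size + 1 = (D.size - 1) + 2 by omega]
        push_cast
        ring
      rw [h4]
      linarith
  refine ⟨E, D, hE1, hDE, ?_, ?_, ?_⟩
  · calc (16 : ℝ) ^ D = (2 ^ D) ^ 4 := by rw [← pow_mul, mul_comm, pow_mul]; norm_num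
      _ ≤ (N / LL) ^ 4 := by gcongr
      _ = _ := div_pow _ _ _
  · calc ((D.size + 1 : ℕ) : ℝ) * 2 ^ (E + D) = ((D.size + 1 : ℕ) : ℝ) * (2 ^ E * 2 ^ D) := by
          rw [pow_add]
      _ ≤ 3 * LL * (2 * n * (N / LL)) := by gcongr
      _ = 6 * N ^ 4 := by
          rw [← hN3]
          field_simp
          ring
  · have h1 : (2 : ℝ) ^ (E - 3 * D) * (2 ^ D) ^ 3 = 2 ^ E := by
      rw [← pow_mul, ← pow_add]
      congr 1
      omega
    have h2 : N ≤ LL * (2 * 2 ^ D) := by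
      rw [div_lt_iff₀ hL0, pow_succ] at hD2
      linarith
    have h3 : (n : ℝ) ≤ 8 * LL ^ 3 * (2 ^ D) ^ 3 := by
      rw [← hN3]
      calc N ^ 3 ≤ (LL * (2 * 2 ^ D)) ^ 3 := by gcongr
        _ = _ := by ring
    have h4 : (2 : ℝ) ^ (E - 3 * D) ≤ 16 * LL ^ 3 := by
      refine le_of_mul_le_mul_right ?_ (show (0 : ℝ) < (2 ^ D) ^ 3 by positivity)
      rw [h1]
      linarith
    linarith

end

theorem partial_brs_for_distance_selection :
    ∃ C : ℝ, C > 0 ∧ ∃ n₀ : ℕ,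
      ∀ (P : Finset Pt) (n : ℕ) (α β : ℝ),
        P.card = n → n₀ ≤ n → 0 ≤ α → α < β →
        ∃ Gm Pm : Finset (Finset Pt × Finset Pt),
          IsPartialBRS P P α β Gm Pm ∧
          (Gm.card : ℝ) ≤
            C * (n : ℝ) ^ ((4 : ℝ) / 3) / (Real.logb 2 (Real.logb 2 (n : ℝ))) ^ 4 ∧
          (∑ p ∈ Gm, (p.1.card : ℝ)) ≤ C * (n : ℝ) ^ ((4 : ℝ) / 3) ∧
          (∑ p ∈ Gm, (p.2.card : ℝ)) ≤ C * (n : ℝ) ^ ((4 : ℝ) / 3) ∧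
          (Pm.card : ℝ) ≤
            C * (n : ℝ) ^ ((4 : ℝ) / 3) / (Real.logb 2 (Real.logb 2 (n : ℝ))) ^ 4 ∧
          (∀ p ∈ Pm, (p.1.card : ℝ) ≤ C * (Real.logb 2 (Real.logb 2 (n : ℝ))) ^ 3 ∧
            (p.2.card : ℝ) ≤ C * (Real.logb 2 (Real.logb 2 (n : ℝ))) ^ 3) ∧
          (∑ p ∈ Pm, (p.1.card : ℝ) * (p.2.card : ℝ)) ≤
            C * (n : ℝ) ^ ((4 : ℝ) / 3) * (Real.logb 2 (Real.logb 2 (n : ℝ))) ^ 2 := by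
  refine ⟨10 ^ 11, by norm_num, 2 ^ 12, fun P n α β hP hn hα hαβ => ?_⟩
  have hL1 : 1 ≤ Real.logb 2 (Real.logb 2 (n : ℝ)) := one_le_logb_logb (by exact_mod_cast hn)
  obtain ⟨E, D, hE, hDE, h16, hsum, hsmall⟩ := exists_depth hn rfl rfl
  have hN : ((n : ℝ) ^ ((1 : ℝ) / 3)) ^ 4 = (n : ℝ) ^ ((4 : ℝ) / 3) := by
    rw [← Real.rpow_natCast, ← Real.rpow_mul (Nat.cast_nonneg n)]
    norm_num
  rw [hN] at h16 hsum
  obtain ⟨G, R, hcov, hG, hG1, hG2, hR, hRs⟩ := exists_bicliqueCover_two_sided P α β hα hαβ E D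
    (hP ▸ hE) hDE
  have hX : 0 ≤ (n : ℝ) ^ ((4 : ℝ) / 3) := by positivity
  generalize (n : ℝ) ^ ((4 : ℝ) / 3) = X at *
  generalize Real.logb 2 (Real.logb 2 (n : ℝ)) = LL at *
  have hL0 : 0 < LL := by linarith
  have hcount : ∀ m : ℕ, m ≤ 10 ^ 6 * 16 ^ D → (m : ℝ) ≤ 10 ^ 6 * (X / LL ^ 4) := fun m hm => by
    have hm' : (m : ℝ) ≤ 10 ^ 6 * 16 ^ D := by exact_mod_cast hm
    linarith
  have hcount' : 10 ^ 6 * (X / LL ^ 4) ≤ 10 ^ 11 * X / LL ^ 4 := by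
    rw [mul_div_assoc]
    gcongr <;> norm_num
  have hincid : ∀ m : ℕ, m ≤ 10 ^ 6 * ((D.size + 1) * 2 ^ (E + D)) → (m : ℝ) ≤ 10 ^ 11 * X :=
    fun m hm => by
      have hm' : (m : ℝ) ≤ 10 ^ 6 * (((D.size + 1 : ℕ) : ℝ) * 2 ^ (E + D)) := by exact_mod_cast hm
      linarith
  have hside : ∀ m : ℕ, m ≤ 8 * 2 ^ (E - 3 * D) → (m : ℝ) ≤ 128 * LL ^ 3 := fun m hm =>
    le_trans (by exact_mod_cast hm) hsmall
  have hside' : 128 * LL ^ 3 ≤ 10 ^ 11 * LL ^ 3 := by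
    gcongr
    norm_num
  refine ⟨G, R, hcov.isPartialBRS, (hcount _ hG).trans hcount', ?_, ?_,
    (hcount _ hR).trans hcount',
    fun p hp => ⟨(hside _ (hRs p hp).1).trans hside', (hside _ (hRs p hp).2).trans hside'⟩, ?_⟩
  · exact_mod_cast hincid _ hG1
  · exact_mod_cast hincid _ hG2
  · calc ∑ p ∈ R, (p.1.card : ℝ) * (p.2.card : ℝ)
        ≤ ∑ p ∈ R, (128 * LL ^ 3) * (128 * LL ^ 3) := by
          refine Finset.sum_le_sum fun p hp => ?_
          have h1 := hside _ (hRs p hp).1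
          have h2 := hside _ (hRs p hp).2
          gcongr
      _ = (R.card : ℝ) * ((128 * LL ^ 3) * (128 * LL ^ 3)) := by simp
      _ ≤ 10 ^ 6 * (X / LL ^ 4) * ((128 * LL ^ 3) * (128 * LL ^ 3)) := by
          gcongr
          exact hcount _ hR
      _ = (10 ^ 6 * 128 ^ 2) * (X * LL ^ 2) := by
          field_simp
      _ ≤ 10 ^ 11 * (X * LL ^ 2) := by
          gcongr
          norm_num
      _ = _ := by ring
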